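/- arXiv:2207.04777 — 3 statements merged into one kernel-verified Lean document; each statement's English description precedes it below -/
import Mathlib

section
/- Let ϱ be Dickman's function, the continuous solution of v·ϱ'(v) = −ϱ(v−1) for v > 1 with ϱ ≡ 1 on [0,1], extended by 0 for v < 0. Its Laplace transform satisfies ϱ̂(s) := ∫_0^∞ e^{−vs} ϱ(v) dv = e^{γ + I(−s)} for all complex s, where I(s) = ∫_0^s (e^t − 1)/t dt and γ is Euler's constant. -/
open MeasureTheory

theorem dk_cont (ϱ : ℝ → ℝ) (hcont : ContinuousOn ϱ (Set.Ici 0)) :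
    Continuous (fun v => ϱ (max v 0)) := by
  rw [← continuousOn_univ]
  exact hcont.comp (by fun_prop) (fun x _ => Set.mem_Ici.2 (le_max_right _ _))

theorem dk_key (ϱ : ℝ → ℝ)
    (hcont : ContinuousOn ϱ (Set.Ici 0))
    (hinit : ∀ v ∈ Set.Icc (0:ℝ) 1, ϱ v = 1)
    (hdde : ∀ v : ℝ, 1 < v → HasDerivAt ϱ (-(ϱ (v - 1)) / v) v) (v : ℝ) (hv : 1 ≤ v) :
    v * ϱ v = ∫ t in (v-1)..v, ϱ t := by
  set r : ℝ → ℝ := fun v => ϱ (max v 0) with hr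
  have hrc : Continuous r := dk_cont ϱ hcont
  have hreq : ∀ x, 0 ≤ x → r x = ϱ x := fun x hx => by simp [hr, max_eq_left hx]
  have h1 : ∫ t in (v-1)..v, ϱ t = ∫ t in (v-1)..v, r t := by
    apply intervalIntegral.integral_congr
    intro x hx
    rw [Set.uIcc_of_le (by linarith)] at hx
    exact (hreq x (by linarith [hx.1])).symm
  rw [h1]
  set P : ℝ → ℝ := fun v => ∫ t in (0:ℝ)..v, r t with hP
  have hPd : ∀ x, HasDerivAt P (r x) x := fun x =>
    intervalIntegral.integral_hasDerivAt_right (hrc.intervalIntegrable _ _)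
      hrc.stronglyMeasurable.stronglyMeasurableAtFilter hrc.continuousAt
  have h2 : ∫ t in (v-1)..v, r t = P v - P (v-1) := by
    rw [hP]
    exact (intervalIntegral.integral_interval_sub_left (hrc.intervalIntegrable _ _)
      (hrc.intervalIntegrable _ _)).symm
  rw [h2]
  have hPc : Continuous P := continuous_iff_continuousAt.2 fun x => (hPd x).continuousAt
  set g : ℝ → ℝ := fun v => v * ϱ v - (P v - P (v-1)) with hg
  have hg1 : g 1 = 0 := by
    have e : P 1 = 1 := by
      have : P 1 = ∫ t in (0:ℝ)..1, (1:ℝ) := by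
        apply intervalIntegral.integral_congr
        intro x hx
        rw [Set.uIcc_of_le (by linarith)] at hx
        simp only
        rw [hreq x hx.1, hinit x hx]
      rw [this]; simp
    have e0 : P 0 = 0 := by simp [hP]
    simp [hg, e, e0, hinit 1 (by simp)]
  suffices g v = 0 by simp only [hg] at this; linarith
  rcases hv.eq_or_lt with rfl | hv
  · exact hg1
  have hgd : ∀ x ∈ Set.Ioo 1 v, HasDerivAt g 0 x := by
    intro x hx
    have hx0 : 0 < x := by linarith [hx.1]
    have := ((hasDerivAt_id x).mul (hdde x hx.1)).sub
      ((hPd x).sub ((hPd (x-1)).comp_sub_const x 1))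
    refine this.congr_deriv ?_
    rw [hreq x hx0.le, hreq (x-1) (by linarith [hx.1])]
    simp only [id]
    field_simp
    ring
  have hgc : ContinuousOn g (Set.Icc 1 v) := by
    refine ContinuousOn.sub (continuousOn_id.mul (hcont.mono ?_)) (Continuous.continuousOn (by fun_prop))
    intro x hx; exact (by linarith [hx.1] : (0:ℝ) ≤ x)
  obtain ⟨c, hc, hc'⟩ := exists_hasDerivAt_eq_slope g (fun _ => 0) hv hgc hgd
  have : v - 1 ≠ 0 := by linarith
  rw [hg1] at hc'
  field_simp at hc'
  linarith

theorem dk_bound_step (ϱ : ℝ → ℝ)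
    (hcont : ContinuousOn ϱ (Set.Ici 0))
    (hinit : ∀ v ∈ Set.Icc (0:ℝ) 1, ϱ v = 1)
    (hdde : ∀ v : ℝ, 1 < v → HasDerivAt ϱ (-(ϱ (v - 1)) / v) v) (v B : ℝ) (hv : 1 ≤ v)
    (hB : ∀ x ∈ Set.Icc (v-1) v, |ϱ x| ≤ B) : v * |ϱ v| ≤ B := by
  have := dk_key ϱ hcont hinit hdde v hv
  have h2 : |v * ϱ v| ≤ B := by
    rw [this]
    have := intervalIntegral.norm_integral_le_of_norm_le_const (f := ϱ) (a := v-1) (b := v) (C := B) 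
      (fun x hx => hB x (by rw [Set.uIoc_of_le (by linarith)] at hx; exact ⟨hx.1.le, hx.2⟩))
    simpa using this
  rwa [abs_mul, abs_of_nonneg (by linarith)] at h2

theorem dk_le_one (ϱ : ℝ → ℝ)
    (hcont : ContinuousOn ϱ (Set.Ici 0))
    (hinit : ∀ v ∈ Set.Icc (0:ℝ) 1, ϱ v = 1)
    (hdde : ∀ v : ℝ, 1 < v → HasDerivAt ϱ (-(ϱ (v - 1)) / v) v) (v : ℝ) (hv : 0 ≤ v) :
    |ϱ v| ≤ 1 := by
  obtain ⟨w, hw, hmax⟩ := (isCompact_Icc (a := (0:ℝ)) (b := v)).exists_isMaxOn ⟨0, by simp [hv]⟩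
    (f := fun x => |ϱ x|) ((hcont.mono (fun x hx => hx.1)).abs)
  have h1 : |ϱ v| ≤ |ϱ w| := hmax ⟨hv, le_rfl⟩
  refine h1.trans ?_
  rcases le_or_gt w 1 with h | h
  · rw [hinit w ⟨hw.1, h⟩]; simp
  · have := dk_bound_step ϱ hcont hinit hdde w (|ϱ w|) h.le 
      (fun x hx => hmax ⟨by linarith [hx.1], by linarith [hx.2, hw.2]⟩)
    nlinarith [abs_nonneg (ϱ w)]

theorem dk_fact (ϱ : ℝ → ℝ)
    (hcont : ContinuousOn ϱ (Set.Ici 0))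
    (hinit : ∀ v ∈ Set.Icc (0:ℝ) 1, ϱ v = 1)
    (hdde : ∀ v : ℝ, 1 < v → HasDerivAt ϱ (-(ϱ (v - 1)) / v) v) (n : ℕ) : 
    ∀ v : ℝ, (n:ℝ) ≤ v → |ϱ v| ≤ 1 / (n.factorial : ℝ) := by
  induction n with
  | zero => intro v hv; simpa using dk_le_one ϱ hcont hinit hdde v (by simpa using hv)
  | succ n ih =>
    intro v hv
    push_cast at hv
    have hn : (0:ℝ) ≤ n := by positivity
    have := dk_bound_step ϱ hcont hinit hdde v _ (by linarith) 
      (fun x hx => ih x (by linarith [hx.1]))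
    have h2 : ((n:ℝ)+1) * |ϱ v| ≤ 1 / (n.factorial : ℝ) := 
      (mul_le_mul_of_nonneg_right hv (abs_nonneg _)).trans this
    have hf : (0:ℝ) < n.factorial := by positivity
    rw [Nat.factorial_succ, le_div_iff₀ (by positivity)]
    rw [le_div_iff₀ hf] at h2
    push_cast
    linarith

theorem dk_decay (ϱ : ℝ → ℝ)
    (hcont : ContinuousOn ϱ (Set.Ici 0))
    (hinit : ∀ v ∈ Set.Icc (0:ℝ) 1, ϱ v = 1)
    (hdde : ∀ v : ℝ, 1 < v → HasDerivAt ϱ (-(ϱ (v - 1)) / v) v) (K : ℝ) (hK : 0 ≤ K) : 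
    ∃ C : ℝ, 0 ≤ C ∧ ∀ v : ℝ, 0 ≤ v → |ϱ v| ≤ C * Real.exp (-K * v) := by
  refine ⟨Real.exp (Real.exp K) * Real.exp K, by positivity, fun v hv => ?_⟩
  have h1 := dk_fact ϱ hcont hinit hdde ⌊v⌋₊ v (Nat.floor_le hv)
  have h2 := Real.pow_div_factorial_le_exp (Real.exp K) (by positivity) ⌊v⌋₊
  have hf : (0:ℝ) < (⌊v⌋₊.factorial : ℝ) := by positivity
  refine h1.trans ?_
  have h3 : Real.exp (K * v) ≤ Real.exp K ^ ⌊v⌋₊ * Real.exp K := by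
    rw [← Real.exp_nat_mul, ← Real.exp_add]
    apply Real.exp_le_exp.2
    nlinarith [Nat.lt_floor_add_one v]
  rw [neg_mul, Real.exp_neg, ← div_eq_mul_inv, le_div_iff₀ (by positivity)]
  calc _ ≤ 1 / (⌊v⌋₊.factorial : ℝ) * (Real.exp K ^ ⌊v⌋₊ * Real.exp K) := by gcongr
    _ = (Real.exp K ^ ⌊v⌋₊ / ⌊v⌋₊.factorial) * Real.exp K := by ring
    _ ≤ _ := by gcongr

theorem dk_meas (ϱ : ℝ → ℝ) (hneg : ∀ v : ℝ, v < 0 → ϱ v = 0)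
    (hcont : ContinuousOn ϱ (Set.Ici 0)) : Measurable ϱ := by
  have : ϱ = (Set.Ici (0:ℝ)).indicator (fun v => ϱ (max v 0)) := by
    ext v
    by_cases h : 0 ≤ v
    · simp [Set.indicator, h]
    · simp [Set.indicator, h, hneg v (not_le.1 h)]
  rw [this]
  exact (dk_cont ϱ hcont).measurable.indicator measurableSet_Ici

theorem dk_conv (ϱ : ℝ → ℝ) (hneg : ∀ v : ℝ, v < 0 → ϱ v = 0)
    (hcont : ContinuousOn ϱ (Set.Ici 0))
    (hinit : ∀ v ∈ Set.Icc (0:ℝ) 1, ϱ v = 1)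
    (hdde : ∀ v : ℝ, 1 < v → HasDerivAt ϱ (-(ϱ (v - 1)) / v) v) (v : ℝ) :
    v * ϱ v = ∫ t in (v-1)..v, ϱ t := by
  rcases le_or_gt 1 v with h | h
  · exact dk_key ϱ hcont hinit hdde v h
  have hint : ∀ a b : ℝ, b ≤ 0 → a ≤ b → ∫ t in a..b, ϱ t = 0 := by
    intro a b hb hab
    rw [intervalIntegral.integral_of_le hab, integral_Ioc_eq_integral_Ioo]
    apply setIntegral_eq_zero_of_forall_eq_zero
    intro x hx
    exact hneg x (by linarith [hx.2])
  rcases lt_or_ge v 0 with h0 | h0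
  · rw [hneg v h0, hint _ _ h0.le (by linarith)]; simp
  · have hm := dk_meas ϱ hneg hcont
    have hb : ∀ x ≤ 1, |ϱ x| ≤ 1 := by
      intro x hx
      rcases lt_or_ge x 0 with h0 | h0
      · simp [hneg x h0]
      · simp [hinit x ⟨h0, hx⟩]
    have hii : ∀ a b : ℝ, a ≤ b → b ≤ 1 → IntervalIntegrable ϱ volume a b := by
      intro a b hab hb1
      refine IntervalIntegrable.mono_fun' (g := fun _ => (1:ℝ)) intervalIntegrable_const
        hm.aestronglyMeasurable ?_
      rw [Filter.EventuallyLE, ae_restrict_iff' measurableSet_uIoc]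
      refine Filter.Eventually.of_forall fun x hx => ?_
      rw [Set.uIoc_of_le hab] at hx
      exact hb x (hx.2.trans hb1)
    rw [← intervalIntegral.integral_add_adjacent_intervals (b := 0) (hii _ _ (by linarith) (by linarith))
      (hii _ _ h0 h.le), hint _ _ le_rfl (by linarith), hinit v ⟨h0, h.le⟩]
    have : ∫ t in (0:ℝ)..v, ϱ t = ∫ t in (0:ℝ)..v, (1:ℝ) := by
      apply intervalIntegral.integral_congr
      intro x hx
      rw [Set.uIcc_of_le h0] at hx
      exact hinit x ⟨hx.1, hx.2.trans h.le⟩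
    rw [this]; simp

theorem dk_dom (ϱ : ℝ → ℝ) (hneg : ∀ v : ℝ, v < 0 → ϱ v = 0)
    (hcont : ContinuousOn ϱ (Set.Ici 0))
    (hinit : ∀ v ∈ Set.Icc (0:ℝ) 1, ϱ v = 1)
    (hdde : ∀ v : ℝ, 1 < v → HasDerivAt ϱ (-(ϱ (v - 1)) / v) v) (R : ℝ) (hR : 0 ≤ R) :
    ∃ b : ℝ → ℝ, Integrable b ∧ ∀ s : ℂ, ‖s‖ ≤ R → ∀ v : ℝ,
      ‖Complex.exp (-(v : ℂ) * s) * (ϱ v : ℂ)‖ ≤ b v ∧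
      ‖-(v : ℂ) * Complex.exp (-(v : ℂ) * s) * (ϱ v : ℂ)‖ ≤ b v := by
  obtain ⟨C, hC, hd⟩ := dk_decay ϱ hcont hinit hdde (R + 2) (by linarith)
  refine ⟨(Set.Ici (0:ℝ)).indicator (fun v => C * Real.exp (-v)), ?_, ?_⟩
  · rw [integrable_indicator_iff measurableSet_Ici, integrableOn_Ici_iff_integrableOn_Ioi]
    exact (integrableOn_exp_neg_Ioi 0).const_mul C
  · intro s hs v
    rcases lt_or_ge v 0 with h0 | h0
    · simp [hneg v h0, h0]
    · have h1 : ‖Complex.exp (-(v : ℂ) * s)‖ ≤ Real.exp (R * v) := by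
        rw [Complex.norm_exp]
        apply Real.exp_le_exp.2
        calc _ ≤ ‖-(v : ℂ) * s‖ := Complex.re_le_norm _
          _ = v * ‖s‖ := by simp [abs_of_nonneg h0]
          _ ≤ _ := by rw [mul_comm]; gcongr
      have h2 : v ≤ Real.exp v := by linarith [Real.add_one_le_exp v]
      have h3 : 1 ≤ Real.exp v := by linarith [Real.add_one_le_exp v]
      have h4 : Real.exp v * Real.exp (R * v) * (C * Real.exp (-(R+2) * v)) = C * Real.exp (-v) := by
        rw [mul_left_comm, ← Real.exp_add, ← Real.exp_add]
        congr 2; ring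
      have hdv := hd v h0
      rw [Set.indicator_of_mem (Set.mem_Ici.2 h0), ← h4]
      simp only [norm_mul, norm_neg, Complex.norm_real, Real.norm_eq_abs, abs_of_nonneg h0]
      constructor
      · gcongr
        calc _ ≤ 1 * Real.exp (R * v) := by rw [one_mul]; exact h1
          _ ≤ _ := by gcongr
      · gcongr

theorem dk_aesm (ϱ : ℝ → ℝ) (hneg : ∀ v : ℝ, v < 0 → ϱ v = 0)
    (hcont : ContinuousOn ϱ (Set.Ici 0)) (s : ℂ) :
    AEStronglyMeasurable (fun v : ℝ => Complex.exp (-(v : ℂ) * s) * (ϱ v : ℂ)) volume := by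
  have := dk_meas ϱ hneg hcont
  exact (by fun_prop : Measurable _).aestronglyMeasurable

theorem dk_intble (ϱ : ℝ → ℝ) (hneg : ∀ v : ℝ, v < 0 → ϱ v = 0)
    (hcont : ContinuousOn ϱ (Set.Ici 0))
    (hinit : ∀ v ∈ Set.Icc (0:ℝ) 1, ϱ v = 1)
    (hdde : ∀ v : ℝ, 1 < v → HasDerivAt ϱ (-(ϱ (v - 1)) / v) v) (s : ℂ) :
    Integrable (fun v : ℝ => Complex.exp (-(v : ℂ) * s) * (ϱ v : ℂ)) := by
  obtain ⟨b, hb, h⟩ := dk_dom ϱ hneg hcont hinit hdde ‖s‖ (norm_nonneg _)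
  exact hb.mono' (dk_aesm ϱ hneg hcont s) (Filter.Eventually.of_forall fun v => (h s le_rfl v).1)

theorem dk_deriv0 (ϱ : ℝ → ℝ) (hneg : ∀ v : ℝ, v < 0 → ϱ v = 0)
    (hcont : ContinuousOn ϱ (Set.Ici 0))
    (hinit : ∀ v ∈ Set.Icc (0:ℝ) 1, ϱ v = 1)
    (hdde : ∀ v : ℝ, 1 < v → HasDerivAt ϱ (-(ϱ (v - 1)) / v) v) (s : ℂ) :
    HasDerivAt (fun s : ℂ => ∫ v : ℝ, Complex.exp (-(v : ℂ) * s) * (ϱ v : ℂ))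
      (∫ v : ℝ, -(v : ℂ) * Complex.exp (-(v : ℂ) * s) * (ϱ v : ℂ)) s := by
  obtain ⟨b, hb, h⟩ := dk_dom ϱ hneg hcont hinit hdde (‖s‖ + 1) (by positivity)
  refine (hasDerivAt_integral_of_dominated_loc_of_deriv_le (bound := b)
    (F' := fun s v => -(v : ℂ) * Complex.exp (-(v : ℂ) * s) * (ϱ v : ℂ)) (Metric.ball_mem_nhds s one_pos)
    (Filter.Eventually.of_forall fun s => dk_aesm ϱ hneg hcont s) 
    (dk_intble ϱ hneg hcont hinit hdde s) ?_ ?_ hb ?_).2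
  · have := dk_meas ϱ hneg hcont
    exact (by fun_prop : Measurable _).aestronglyMeasurable
  · refine Filter.Eventually.of_forall fun v x hx => (h x ?_ v).2
    have := norm_sub_norm_le x s
    rw [Metric.mem_ball, dist_eq_norm] at hx
    linarith
  · refine Filter.Eventually.of_forall fun v x hx => ?_
    have := (((hasDerivAt_id x).const_mul (-(v:ℂ))).cexp).mul_const (ϱ v : ℂ)
    refine this.congr_deriv ?_
    simp only [id]; ring

theorem dk_deriv (ϱ : ℝ → ℝ) (hneg : ∀ v : ℝ, v < 0 → ϱ v = 0)
    (hcont : ContinuousOn ϱ (Set.Ici 0))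
    (hinit : ∀ v ∈ Set.Icc (0:ℝ) 1, ϱ v = 1)
    (hdde : ∀ v : ℝ, 1 < v → HasDerivAt ϱ (-(ϱ (v - 1)) / v) v) (s : ℂ) :
    HasDerivAt (fun s : ℂ => ∫ v : ℝ, Complex.exp (-(v : ℂ) * s) * (ϱ v : ℂ))
      (-((∫ v : ℝ, Complex.exp (-(v : ℂ) * s) * (ϱ v : ℂ)) * 
        ∫ t in (0:ℝ)..1, Complex.exp (-(t : ℂ) * s))) s := by
  refine (dk_deriv0 ϱ hneg hcont hinit hdde s).congr_deriv ?_
  set g : ℝ → ℂ := (Set.Ico (0:ℝ) 1).indicator (fun t => Complex.exp (-(t : ℂ) * s)) with hg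
  have hgi : Integrable g := by
    rw [hg, integrable_indicator_iff measurableSet_Ico]
    exact (Continuous.integrableOn_Icc (by fun_prop)).mono_set Set.Ico_subset_Icc_self
  have hc := integral_convolution (μ := volume) (ν := volume) (ContinuousLinearMap.mul ℂ ℂ) 
    (dk_intble ϱ hneg hcont hinit hdde s) hgi
  rw [ContinuousLinearMap.mul_apply'] at hc
  have hg2 : ∫ x, g x = ∫ t in (0:ℝ)..1, Complex.exp (-(t : ℂ) * s) := by
    rw [hg, integral_indicator measurableSet_Ico, intervalIntegral.integral_of_le zero_le_one,
      integral_Ico_eq_integral_Ioo, integral_Ioc_eq_integral_Ioo]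
  rw [hg2] at hc
  rw [← hc, ← integral_neg]
  congr 1
  ext v
  rw [convolution_def]
  have : ∀ t : ℝ, (ContinuousLinearMap.mul ℂ ℂ (Complex.exp (-(t : ℂ) * s) * (ϱ t : ℂ))) (g (v - t))
      = (Set.Ioc (v-1) v).indicator (fun t => Complex.exp (-(v : ℂ) * s) * (ϱ t : ℂ)) t := by
    intro t
    by_cases ht : t ∈ Set.Ioc (v-1) v
    · have ht' : v - t ∈ Set.Ico (0:ℝ) 1 := ⟨by linarith [ht.2], by linarith [ht.1]⟩
      rw [hg, Set.indicator_of_mem ht, Set.indicator_of_mem ht', ContinuousLinearMap.mul_apply',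
        mul_right_comm, ← Complex.exp_add]
      congr 2
      push_cast; ring
    · have ht' : v - t ∉ Set.Ico (0:ℝ) 1 := fun h => ht ⟨by linarith [h.2], by linarith [h.1]⟩
      rw [hg, Set.indicator_of_notMem ht, Set.indicator_of_notMem ht']
      simp
  simp_rw [this]
  rw [integral_indicator measurableSet_Ioc, ← intervalIntegral.integral_of_le (by linarith),
    intervalIntegral.integral_const_mul, intervalIntegral.integral_ofReal, 
    ← dk_conv ϱ hneg hcont hinit hdde v]
  push_cast
  ring

theorem dk_Ideriv (s : ℂ) : 
    HasDerivAt (fun s : ℂ => ∫ t in (0:ℝ)..1, (Complex.exp ((t : ℂ) * (-s)) - 1) / (t : ℂ))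
      (-∫ t in (0:ℝ)..1, Complex.exp (-(t : ℂ) * s)) s := by
  rw [← intervalIntegral.integral_neg]
  have hd : ∀ t : ℝ, t ∈ Set.uIoc (0:ℝ) 1 → ∀ x : ℂ,
      HasDerivAt (fun s : ℂ => (Complex.exp ((t : ℂ) * (-s)) - 1) / (t : ℂ)) 
        (-Complex.exp (-(t : ℂ) * x)) x := by
    intro t ht x
    rw [Set.uIoc_of_le zero_le_one] at ht
    have h0 : (t:ℂ) ≠ 0 := by exact_mod_cast ht.1.ne'
    have := ((((hasDerivAt_id x).neg.const_mul (t:ℂ)).cexp).sub_const 1).div_const (t:ℂ)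
    refine this.congr_deriv ?_
    simp only [id, Pi.neg_apply]
    field_simp
  have hb : ∀ t : ℝ, t ∈ Set.uIoc (0:ℝ) 1 → ∀ x : ℂ, 
      ‖-Complex.exp (-(t : ℂ) * x)‖ ≤ Real.exp ‖x‖ := by
    intro t ht x
    rw [Set.uIoc_of_le zero_le_one] at ht
    rw [norm_neg, Complex.norm_exp]
    apply Real.exp_le_exp.2
    calc _ ≤ ‖-(t : ℂ) * x‖ := Complex.re_le_norm _
      _ = t * ‖x‖ := by simp [abs_of_nonneg ht.1.le]
      _ ≤ 1 * ‖x‖ := by gcongr; exact ht.2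
      _ = _ := one_mul _
  have hm : ∀ x : ℂ, AEStronglyMeasurable (fun t : ℝ => (Complex.exp ((t : ℂ) * (-x)) - 1) / (t : ℂ)) 
      (volume.restrict (Set.uIoc (0:ℝ) 1)) := fun x => 
    (by fun_prop : Measurable _).aestronglyMeasurable
  refine (intervalIntegral.hasDerivAt_integral_of_dominated_loc_of_deriv_le 
    (F' := fun s t => -Complex.exp (-(t : ℂ) * s)) (bound := fun _ => Real.exp (‖s‖ + 1)) (Metric.ball_mem_nhds s one_pos)
    (Filter.Eventually.of_forall hm) ?_ ?_ ?_ intervalIntegrable_const 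
    (Filter.Eventually.of_forall fun t ht x _ => hd t ht x)).2
  · refine IntervalIntegrable.mono_fun' (g := fun _ => Real.exp ‖s‖ * ‖s‖) intervalIntegrable_const
        (hm s) ?_
    rw [Filter.EventuallyLE, ae_restrict_iff' measurableSet_uIoc]
    refine Filter.Eventually.of_forall fun t ht => ?_
    have := (convex_closedBall (0:ℂ) ‖s‖).norm_image_sub_le_of_norm_hasDerivWithin_le
      (C := Real.exp ‖s‖) (fun x _ => (hd t ht x).hasDerivWithinAt) 
      (fun x hx => (hb t ht x).trans (Real.exp_le_exp.2 (by simpa using hx))) 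
      (x := 0) (y := s) (by simp) (by simp)
    simpa using this
  · exact (by fun_prop : Measurable _).aestronglyMeasurable
  · refine Filter.Eventually.of_forall fun t ht x hx => (hb t ht x).trans (Real.exp_le_exp.2 ?_)
    have := norm_sub_norm_le x s
    rw [Metric.mem_ball, dist_eq_norm] at hx
    linarith

theorem dk_gamma_bound (n : ℕ) (t : ℝ) (ht : 0 < t) (ht1 : t ≤ 1) :
    0 ≤ (Real.exp (-(n * t)) - (1 - t) ^ n) / t ∧
    (Real.exp (-(n * t)) - (1 - t) ^ n) / t ≤ (n * t) * Real.exp (-(n * t)) := by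
  have he : Real.exp (-(n * t)) = Real.exp (-t) ^ n := by
    rw [← Real.exp_nat_mul]; congr 1; ring
  constructor
  · apply div_nonneg _ ht.le
    rw [he, sub_nonneg]
    exact pow_le_pow_left₀ (by linarith) (by linarith [Real.add_one_le_exp (-t)]) n
  · rw [div_le_iff₀ ht]
    have h1 : Real.exp (-t) * (1 + -t^2) ≤ 1 - t := by
      have : Real.exp (-t) * (1 + t) ≤ 1 := by
        rw [Real.exp_neg, inv_mul_le_iff₀ (Real.exp_pos t)]
        linarith [Real.add_one_le_exp t]
      nlinarith
    have h2 : (1:ℝ) + n * (-t^2) ≤ (1 + -t^2)^n := one_add_mul_le_pow (by nlinarith) n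
    have h3 : (Real.exp (-t) * (1 + -t^2))^n ≤ (1 - t)^n := 
      pow_le_pow_left₀ (mul_nonneg (Real.exp_pos _).le (by nlinarith)) h1 n
    rw [mul_pow] at h3
    rw [he]
    have h4 := mul_le_mul_of_nonneg_left h2 (by positivity : 0 ≤ Real.exp (-t)^n)
    nlinarith

theorem dk_harm (n : ℕ) : 
    ∫ t in (0:ℝ)..1, ∑ k ∈ Finset.range n, (1 - t) ^ k = (harmonic n : ℝ) := by
  rw [intervalIntegral.integral_finsetSum (fun k _ => Continuous.intervalIntegrable (by fun_prop) _ _)]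
  rw [harmonic]
  push_cast
  refine Finset.sum_congr rfl fun k _ => ?_
  rw [intervalIntegral.integral_comp_sub_left (fun x => x ^ k) 1]
  simp [integral_pow]

theorem dk_gamma0 : Filter.Tendsto (fun n : ℕ => 
    (∫ t in (0:ℝ)..1, (Real.exp (-(n * t)) - 1) / t) + (harmonic n : ℝ)) Filter.atTop (nhds 0) := by
  have hii : ∀ n : ℕ, IntervalIntegrable (fun t : ℝ => (Real.exp (-(n * t)) - 1) / t) volume 0 1 := by
    intro n
    refine IntervalIntegrable.mono_fun' (g := fun _ => (n:ℝ)) intervalIntegrable_const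
      (by fun_prop : Measurable _).aestronglyMeasurable ?_
    rw [Filter.EventuallyLE, ae_restrict_iff' measurableSet_uIoc]
    refine Filter.Eventually.of_forall fun t ht => ?_
    rw [Set.uIoc_of_le zero_le_one] at ht
    have h1 := Real.add_one_le_exp (-(n * t))
    have h2 : Real.exp (-(n * t)) ≤ 1 := Real.exp_le_one_iff.2 (by have := ht.1; simp only [Left.neg_nonpos_iff]; positivity)
    rw [Real.norm_eq_abs, abs_div, abs_of_pos ht.1, div_le_iff₀ ht.1, abs_of_nonpos (by linarith)]
    linarith
  have heq : ∀ n : ℕ, (∫ t in (0:ℝ)..1, (Real.exp (-(n * t)) - 1) / t) + (harmonic n : ℝ)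
      = ∫ t in (0:ℝ)..1, (Real.exp (-(n * t)) - (1 - t) ^ n) / t := by
    intro n
    rw [← dk_harm n, ← intervalIntegral.integral_add (hii n) (Continuous.intervalIntegrable (by fun_prop) _ _)]
    apply intervalIntegral.integral_congr_ae
    refine Filter.Eventually.of_forall fun t ht => ?_
    rw [Set.uIoc_of_le zero_le_one] at ht
    have h0 := ht.1.ne'
    have := geom_sum_mul (1 - t) n
    field_simp
    linarith
  simp_rw [heq]
  have h0 : (0:ℝ) = ∫ t in (0:ℝ)..1, (0:ℝ) := by simp
  suffices H : Filter.Tendsto (fun n : ℕ => ∫ t in (0:ℝ)..1, (Real.exp (-(n * t)) - (1 - t) ^ n) / t)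
      Filter.atTop (nhds (∫ t in (0:ℝ)..1, (0:ℝ))) by rwa [← h0] at H
  refine intervalIntegral.tendsto_integral_filter_of_dominated_convergence (fun _ => 1) 
    (Filter.Eventually.of_forall fun n => (by fun_prop : Measurable _).aestronglyMeasurable) 
    (Filter.Eventually.of_forall fun n => Filter.Eventually.of_forall fun t ht => ?_) 
    intervalIntegrable_const (Filter.Eventually.of_forall fun t ht => ?_)
  · rw [Set.uIoc_of_le zero_le_one] at ht
    have := dk_gamma_bound n t ht.1 ht.2
    rw [Real.norm_eq_abs, abs_of_nonneg this.1]
    refine this.2.trans ?_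
    rw [Real.exp_neg, ← div_eq_mul_inv, div_le_one (Real.exp_pos _)]
    linarith [Real.add_one_le_exp (n * t)]
  · rw [Set.uIoc_of_le zero_le_one] at ht
    refine squeeze_zero (fun n => (dk_gamma_bound n t ht.1 ht.2).1) 
      (fun n => (dk_gamma_bound n t ht.1 ht.2).2) ?_
    have h1 : Filter.Tendsto (fun n : ℕ => (n:ℝ) * t) Filter.atTop Filter.atTop :=
      tendsto_natCast_atTop_atTop.atTop_mul_const ht.1
    have h2 := (Real.tendsto_pow_mul_exp_neg_atTop_nhds_zero 1).comp h1
    simpa [Function.comp_def] using h2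

theorem dk_lim (ϱ : ℝ → ℝ) (hneg : ∀ v : ℝ, v < 0 → ϱ v = 0)
    (hcont : ContinuousOn ϱ (Set.Ici 0))
    (hinit : ∀ v ∈ Set.Icc (0:ℝ) 1, ϱ v = 1)
    (hdde : ∀ v : ℝ, 1 < v → HasDerivAt ϱ (-(ϱ (v - 1)) / v) v) :
    Filter.Tendsto (fun n : ℕ => (n:ℂ) * 
      ∫ v in Set.Ioi (0:ℝ), Complex.exp (-(v : ℂ) * (n:ℂ)) * (ϱ v : ℂ)) Filter.atTop (nhds 1) := by
  have hm := dk_meas ϱ hneg hcont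
  have h1 : Filter.Tendsto (fun n : ℕ => ∫ u in Set.Ioi (0:ℝ), 
      ((Real.exp (-u) * ϱ (u / n) : ℝ) : ℂ)) Filter.atTop 
      (nhds (∫ u in Set.Ioi (0:ℝ), ((Real.exp (-u) : ℝ) : ℂ))) := by
    refine tendsto_integral_of_dominated_convergence (fun u => Real.exp (-u)) 
      (fun n => (by fun_prop : Measurable _).aestronglyMeasurable) (integrableOn_exp_neg_Ioi 0) 
      (fun n => ?_) ?_
    · rw [ae_restrict_iff' measurableSet_Ioi]
      refine Filter.Eventually.of_forall fun u hu => ?_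
      have hu : 0 < u := hu
      have := dk_le_one ϱ hcont hinit hdde (u / n) (by positivity)
      rw [Complex.norm_real, Real.norm_eq_abs, abs_mul, abs_of_pos (Real.exp_pos _)]
      exact mul_le_of_le_one_right (Real.exp_pos _).le this
    · rw [ae_restrict_iff' measurableSet_Ioi]
      refine Filter.Eventually.of_forall fun u hu => ?_
      have hu : 0 < u := hu
      apply tendsto_const_nhds.congr'
      filter_upwards [Filter.eventually_ge_atTop (⌈u⌉₊ + 1)] with n hn
      have h2 : u ≤ n := (Nat.le_ceil u).trans (by exact_mod_cast (by omega : ⌈u⌉₊ ≤ n))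
      have h3 : (0:ℝ) < n := by linarith
      rw [hinit (u / n) ⟨by positivity, by rw [div_le_one h3]; exact h2⟩, mul_one]
  have h7 : ∫ u in Set.Ioi (0:ℝ), ((Real.exp (-u) : ℝ) : ℂ) = 1 := by
    rw [integral_complex_ofReal, integral_exp_neg_Ioi_zero, Complex.ofReal_one]
  rw [h7] at h1
  refine h1.congr' ?_
  filter_upwards [Filter.eventually_gt_atTop 0] with n hn
  have hn' : (0:ℝ) < n := by exact_mod_cast hn
  have hnc : (n:ℂ) ≠ 0 := by exact_mod_cast hn.ne'
  have := integral_comp_mul_left_Ioi (fun u : ℝ => ((Real.exp (-u) * ϱ (u / n) : ℝ) : ℂ)) 0 hn'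
  rw [mul_zero] at this
  have h5 : ∫ v in Set.Ioi (0:ℝ), Complex.exp (-(v : ℂ) * (n:ℂ)) * (ϱ v : ℂ) = 
      ∫ (x : ℝ) in Set.Ioi 0, ((Real.exp (-(n * x)) * ϱ (n * x / n) : ℝ) : ℂ) := by
    congr 1
    ext v
    rw [mul_div_cancel_left₀ _ hn'.ne']
    push_cast
    congr 2
    ring
  rw [h5, this, Complex.real_smul]
  push_cast
  rw [mul_inv_cancel_left₀ hnc]

open MeasureTheory

/-- The Laplace transform of Dickman's function: `ϱ̂(s) = e^{γ + I(−s)}` for all `s ∈ ℂ`,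
where `I(s) = ∫_0^s (e^t − 1)/t dt` (parametrized along the segment `[0, s]`). -/
theorem dickman_laplace (ϱ : ℝ → ℝ)
    (hneg : ∀ v : ℝ, v < 0 → ϱ v = 0)
    (hcont : ContinuousOn ϱ (Set.Ici 0))
    (hinit : ∀ v ∈ Set.Icc (0:ℝ) 1, ϱ v = 1)
    (hdde : ∀ v : ℝ, 1 < v → HasDerivAt ϱ (-(ϱ (v - 1)) / v) v)
    (I : ℂ → ℂ)
    (hI : ∀ s : ℂ, I s = ∫ t in (0:ℝ)..1, (Complex.exp ((t : ℂ) * s) - 1) / (t : ℂ)) :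
    ∀ s : ℂ, ∫ v in Set.Ioi (0:ℝ), Complex.exp (-(v : ℂ) * s) * (ϱ v : ℂ)
      = Complex.exp ((Real.eulerMascheroniConstant : ℂ) + I (-s)) := by
  have hfull : ∀ s : ℂ, ∫ v in Set.Ioi (0:ℝ), Complex.exp (-(v : ℂ) * s) * (ϱ v : ℂ)
      = ∫ v : ℝ, Complex.exp (-(v : ℂ) * s) * (ϱ v : ℂ) := by
    intro s
    rw [← integral_Ici_eq_integral_Ioi]
    apply setIntegral_eq_integral_of_forall_compl_eq_zero
    intro v hv
    rw [hneg v (by simpa using hv)]; simp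
  set F : ℂ → ℂ := fun s => ∫ v in Set.Ioi (0:ℝ), Complex.exp (-(v : ℂ) * s) * (ϱ v : ℂ) with hF
  have hFd : ∀ s, HasDerivAt F (-(F s * ∫ t in (0:ℝ)..1, Complex.exp (-(t : ℂ) * s))) s := by
    intro s
    have : F = fun s : ℂ => ∫ v : ℝ, Complex.exp (-(v : ℂ) * s) * (ϱ v : ℂ) := funext hfull
    rw [this]
    exact dk_deriv ϱ hneg hcont hinit hdde s
  have hId : ∀ s, HasDerivAt (fun s => I (-s)) (-∫ t in (0:ℝ)..1, Complex.exp (-(t : ℂ) * s)) s := by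
    intro s
    simp_rw [hI]
    exact dk_Ideriv s
  set G : ℂ → ℂ := fun s => F s * Complex.exp (-(I (-s))) with hG
  have hGd : ∀ s, HasDerivAt G 0 s := by
    intro s
    refine ((hFd s).mul (hId s).neg.cexp).congr_deriv ?_
    simp only [Pi.neg_apply]
    ring
  have hGc : ∀ s w, G s = G w := is_const_of_deriv_eq_zero (fun s => (hGd s).differentiableAt) 
    (fun s => (hGd s).deriv)
  have hlim : Filter.Tendsto (fun n : ℕ => G n) Filter.atTop 
      (nhds (Complex.exp (Real.eulerMascheroniConstant : ℂ))) := by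
    have h1 := dk_lim ϱ hneg hcont hinit hdde
    have h2 : Filter.Tendsto (fun n : ℕ => Real.exp (((harmonic n : ℝ) - Real.log n) - 
        ((∫ t in (0:ℝ)..1, (Real.exp (-(n * t)) - 1) / t) + (harmonic n : ℝ)))) Filter.atTop 
        (nhds (Real.exp (Real.eulerMascheroniConstant - 0))) :=
      (Real.continuous_exp.tendsto _).comp (Real.tendsto_harmonic_sub_log.sub dk_gamma0)
    have h3 := h1.mul ((Complex.continuous_ofReal.tendsto _).comp h2)
    rw [sub_zero, one_mul, Complex.ofReal_exp] at h3
    refine h3.congr' ?_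
    filter_upwards [Filter.eventually_gt_atTop 0] with n hn
    have hn' : (0:ℝ) < n := by exact_mod_cast hn
    have hnc : (n:ℂ) ≠ 0 := by exact_mod_cast hn.ne'
    have hIn : I (-(n:ℂ)) = ((∫ t in (0:ℝ)..1, (Real.exp (-(n * t)) - 1) / t : ℝ) : ℂ) := by
      rw [hI, ← intervalIntegral.integral_ofReal]
      congr 1
      ext t
      push_cast
      congr 3
      ring
    simp only [hG, hF, Function.comp_apply]
    rw [hIn]
    set J : ℝ := ∫ t in (0:ℝ)..1, (Real.exp (-(n * t)) - 1) / t
    have h6 : Real.exp ((harmonic n : ℝ) - Real.log n - (J + (harmonic n : ℝ))) = Real.exp (-J) / n := by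
      rw [show (harmonic n : ℝ) - Real.log n - (J + (harmonic n : ℝ)) = -J - Real.log n by ring,
        Real.exp_sub, Real.exp_log hn']
    rw [h6]
    push_cast
    field_simp
  intro s
  have hGs : G s = Complex.exp (Real.eulerMascheroniConstant : ℂ) := by
    refine tendsto_nhds_unique (tendsto_const_nhds.congr fun n : ℕ => ?_) hlim
    exact hGc s n
  rw [Complex.exp_add, ← hGs]
  change F s = F s * Complex.exp (-(I (-s))) * Complex.exp (I (-s))
  rw [mul_assoc, ← Complex.exp_add]
  simp
end

section
/- Let κ > 0 and let h_κ be the continuous solution of v·h_κ'(v) = κ·h_κ(v−1) (v > 1) with h_κ ≡ 1 on [0,1]. Then for Re s > 0 its Laplace transform satisfies ĥ_κ(s) = 1/(s^{κ+1} ϱ̂(s)^κ), where ϱ̂(s) = e^{γ + I(−s)} is the Laplace transform of Dickman's function and I(s) = ∫_0^s (e^t − 1)/t dt. -/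
open MeasureTheory

lemma hk_J_deriv (s : ℂ) :
    HasDerivAt (fun s : ℂ => ∫ t in (0:ℝ)..1, (Complex.exp ((t : ℂ) * s) - 1) / (t : ℂ))
      (∫ t in (0:ℝ)..1, Complex.exp ((t : ℂ) * s)) s := by
  have hint : IntervalIntegrable (fun t : ℝ => (Complex.exp ((t : ℂ) * s) - 1) / (t : ℂ))
      volume 0 1 := by
    have hc : Continuous (dslope (fun t : ℝ => Complex.exp ((t : ℂ) * s)) 0) := by
      rw [← continuousOn_univ, continuousOn_dslope Filter.univ_mem]
      refine ⟨by fun_prop, ?_⟩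
      have : HasDerivAt (fun t : ℝ => Complex.exp ((t : ℂ) * s)) _ 0 :=
        (((Complex.ofRealCLM.hasDerivAt (x := (0:ℝ))).mul_const s).cexp)
      exact this.differentiableAt
    refine (hc.intervalIntegrable 0 1).congr ?_
    intro t ht
    rw [Set.uIoc_of_le zero_le_one] at ht
    have : t ≠ 0 := ht.1.ne'
    simp [dslope_of_ne _ this, slope_def_module, div_eq_inv_mul]
  refine (intervalIntegral.hasDerivAt_integral_of_dominated_loc_of_deriv_le
    (F' := fun s t => Complex.exp ((t : ℂ) * s))
    (bound := fun _ => Real.exp (‖s‖ + 1)) (Metric.ball_mem_nhds s one_pos) ?_ hint ?_ ?_ ?_ ?_).2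
  · refine Filter.Eventually.of_forall fun x => ?_
    exact Measurable.aestronglyMeasurable (by fun_prop)
  · exact Measurable.aestronglyMeasurable (by fun_prop)
  · refine Filter.Eventually.of_forall fun t ht x hx => ?_
    rw [Set.uIoc_of_le zero_le_one] at ht
    refine (Complex.norm_exp_le_exp_norm _).trans (Real.exp_le_exp.2 ?_)
    have h1 : ‖x‖ ≤ ‖s‖ + 1 := by
      have := norm_le_norm_add_norm_sub' x s
      rw [Metric.mem_ball, dist_eq_norm] at hx
      linarith
    rw [norm_mul, Complex.norm_real, Real.norm_of_nonneg ht.1.le]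
    nlinarith [ht.1, ht.2, norm_nonneg x]
  · simp
  · refine Filter.Eventually.of_forall fun t ht x hx => ?_
    rw [Set.uIoc_of_le zero_le_one] at ht
    have ht0 : (t : ℂ) ≠ 0 := by exact_mod_cast ht.1.ne'
    have := ((((hasDerivAt_id x).const_mul (t : ℂ)).cexp).sub_const 1).div_const (t : ℂ)
    refine this.congr_deriv ?_
    simp [ht0]

lemma hk_logint : IntegrableOn (fun t : ℝ => ((Real.log t : ℝ) : ℂ) * Real.exp (-t)) (Set.Ioi 0) ∧
    ∫ t in Set.Ioi (0:ℝ), ((Real.log t : ℝ) : ℂ) * Real.exp (-t)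
      = -(Real.eulerMascheroniConstant : ℂ) := by
  have h1 := Complex.hasDerivAt_GammaIntegral (s := 1) (by simp)
  have h2 : HasDerivAt Complex.GammaIntegral (-(Real.eulerMascheroniConstant : ℂ)) 1 := by
    refine Complex.hasDerivAt_Gamma_one.congr_of_eventuallyEq ?_
    have : IsOpen {s : ℂ | 0 < s.re} := Complex.continuous_re.isOpen_preimage _ isOpen_Ioi
    filter_upwards [this.mem_nhds (show (0:ℝ) < (1:ℂ).re by simp)] with a ha
    exact (Complex.Gamma_eq_integral ha).symm
  have h3 := h1.unique h2
  simp only [sub_self, Complex.cpow_zero, one_mul] at h3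
  refine ⟨?_, h3⟩
  refine MeasureTheory.Integrable.of_integral_ne_zero ?_
  rw [h3]
  have := Real.one_half_lt_eulerMascheroniConstant
  have h4 : Real.eulerMascheroniConstant ≠ 0 := by linarith
  simpa using h4

lemma hk_J_lim : Filter.Tendsto (fun x : ℝ => ((Real.log x : ℝ) : ℂ) +
    ∫ t in (0:ℝ)..1, (Complex.exp ((t : ℂ) * (-(x:ℂ))) - 1) / (t : ℂ)) Filter.atTop
    (nhds (-(Real.eulerMascheroniConstant : ℂ))) := by
  set J : ℂ → ℂ := fun s => ∫ t in (0:ℝ)..1, (Complex.exp ((t : ℂ) * s) - 1) / (t : ℂ) with hJ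
  have hJ0 : J 0 = 0 := by simp [hJ]
  obtain ⟨hi, hv⟩ := hk_logint
  have hd : ∀ x : ℝ, HasDerivAt (fun x : ℝ => J (-(x:ℂ)))
      (-(∫ t in (0:ℝ)..1, Complex.exp ((t : ℂ) * (-(x:ℂ))))) x := by
    intro x
    have h1 : HasDerivAt (fun z : ℂ => J (-z)) _ (x:ℂ) :=
      (hk_J_deriv (-(x:ℂ))).comp (x:ℂ) (hasDerivAt_neg (x:ℂ))
    have := h1.comp_ofReal
    simpa using this
  set ψ : ℝ → ℂ := fun x => ((Real.log x : ℝ) : ℂ) + J (-(x:ℂ)) -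
    ((Real.log x * Real.exp (-x) : ℝ) : ℂ) with hψ
  have hψd : ∀ x : ℝ, 0 < x → HasDerivAt ψ (((Real.log x : ℝ) : ℂ) * Real.exp (-x)) x := by
    intro x hx
    have hxc : (x:ℂ) ≠ 0 := by exact_mod_cast hx.ne'
    have a1 := (Real.hasDerivAt_log hx.ne').ofReal_comp
    have a2 := ((Real.hasDerivAt_log hx.ne').mul ((hasDerivAt_neg x).exp)).ofReal_comp
    refine ((a1.add (hd x)).sub a2).congr_deriv ?_
    have : ∫ t in (0:ℝ)..1, Complex.exp ((t : ℂ) * (-(x:ℂ))) =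
        (1 - Complex.exp (-x)) / x := by
      have := integral_exp_mul_complex (a := 0) (b := 1) (c := -(x:ℂ)) (by simpa using hxc)
      simp only [mul_comm (-(x:ℂ))] at this
      rw [this]
      field_simp
      simp
    rw [this]
    push_cast
    field_simp
    ring
  have h0 : Filter.Tendsto ψ (nhdsWithin 0 (Set.Ioi 0)) (nhds 0) := by
    have b1 : Filter.Tendsto (fun x : ℝ => J (-(x:ℂ))) (nhdsWithin 0 (Set.Ioi 0)) (nhds 0) := by
      have := (hd 0).continuousAt.tendsto
      simp only [Complex.ofReal_zero, neg_zero, hJ0] at this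
      exact this.mono_left nhdsWithin_le_nhds
    have b2 : Filter.Tendsto (fun x : ℝ => Real.log x * (1 - Real.exp (-x)))
        (nhdsWithin 0 (Set.Ioi 0)) (nhds 0) := by
      have c1 := tendsto_log_mul_rpow_nhdsGT_zero one_pos
      rw [tendsto_zero_iff_norm_tendsto_zero] at c1 ⊢
      refine squeeze_zero' (Filter.Eventually.of_forall fun _ => norm_nonneg _) ?_ c1
      filter_upwards [self_mem_nhdsWithin] with x hx
      have hx : 0 < x := hx
      rw [norm_mul, norm_mul]
      gcongr
      rw [Real.rpow_one, Real.norm_of_nonneg hx.le, Real.norm_of_nonneg]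
      · linarith [Real.add_one_le_exp (-x)]
      · have : Real.exp (-x) ≤ 1 := Real.exp_le_one_iff.2 (by linarith)
        linarith
    have b3 := b1.add ((Complex.continuous_ofReal.tendsto 0).comp b2)
    simp only [Complex.ofReal_zero, add_zero] at b3
    refine b3.congr fun x => ?_
    simp [hψ]
    ring
  have hint : ∀ x : ℝ, 0 < x →
      ∫ t in (0:ℝ)..x, ((Real.log t : ℝ) : ℂ) * Real.exp (-t) = ψ x := by
    intro x hx
    have := intervalIntegral.integral_eq_sub_of_hasDerivAt_of_tendsto (f := ψ)
      (f' := fun t => ((Real.log t : ℝ) : ℂ) * Real.exp (-t)) hx (fun y hy => hψd y hy.1)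
      ((intervalIntegrable_iff_integrableOn_Ioc_of_le hx.le).2
        (hi.mono_set Set.Ioc_subset_Ioi_self)) h0
      ((hψd x hx).continuousAt.tendsto.mono_left nhdsWithin_le_nhds)
    simpa using this
  have hlim : Filter.Tendsto ψ Filter.atTop (nhds (-(Real.eulerMascheroniConstant : ℂ))) := by
    have := intervalIntegral_tendsto_integral_Ioi 0 hi Filter.tendsto_id
    rw [hv] at this
    refine this.congr' ?_
    filter_upwards [Filter.eventually_gt_atTop 0] with x hx
    exact hint x hx
  have hz : Filter.Tendsto (fun x : ℝ => Real.log x * Real.exp (-x)) Filter.atTop (nhds 0) := by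
    have c1 := Real.tendsto_pow_mul_exp_neg_atTop_nhds_zero 1
    refine squeeze_zero' ?_ ?_ c1
    · filter_upwards [Filter.eventually_ge_atTop 1] with x hx
      exact mul_nonneg (Real.log_nonneg hx) (Real.exp_pos _).le
    · filter_upwards [Filter.eventually_ge_atTop 1] with x hx
      have := Real.log_le_sub_one_of_pos (show 0 < x by linarith)
      gcongr
      rw [pow_one]; linarith
  have hf := hlim.add ((Complex.continuous_ofReal.tendsto 0).comp hz)
  simp only [Complex.ofReal_zero, add_zero] at hf
  refine hf.congr fun x => ?_
  simp [hψ, hJ]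

lemma hk_bounds (κ : ℝ) (hκ : 0 < κ) (h : ℝ → ℝ)
    (hcont : ContinuousOn h (Set.Ici 0))
    (hinit : ∀ v ∈ Set.Icc (0:ℝ) 1, h v = 1)
    (hdde : ∀ v : ℝ, 1 < v → HasDerivAt h (κ * h (v - 1) / v) v) :
    ∀ v : ℝ, 0 ≤ v → 0 ≤ h v ∧ h v ≤ (1 + v) ^ κ := by
  have key : ∀ n : ℕ, ∀ v ∈ Set.Icc (0:ℝ) (n+1), 1 ≤ h v := by
    intro n
    induction n with
    | zero => intro v hv; rw [hinit v (by simpa using hv)]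
    | succ n ih =>
      intro v hv
      by_cases hv1 : v ≤ 1
      · rw [hinit v ⟨hv.1, hv1⟩]
      push Not at hv1
      have hm : MonotoneOn h (Set.Icc 1 v) := by
        refine monotoneOn_of_deriv_nonneg (convex_Icc _ _)
          (hcont.mono fun x hx => ?_) ?_ ?_
        · exact zero_le_one.trans hx.1
        · rw [interior_Icc]
          exact fun x hx => (hdde x hx.1).differentiableAt.differentiableWithinAt
        · rw [interior_Icc]
          intro x hx
          rw [(hdde x hx.1).deriv]
          have h2 := hv.2
          push_cast at h2
          have := ih (x - 1) ⟨by linarith [hx.1], by linarith [hx.2]⟩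
          have hx1 := hx.1
          positivity
      have := hm ⟨le_rfl, hv1.le⟩ ⟨hv1.le, le_rfl⟩ hv1.le
      rwa [hinit 1 (by simp)] at this
  have hge : ∀ v : ℝ, 0 ≤ v → 1 ≤ h v := by
    intro v hv
    obtain ⟨n, hn⟩ := exists_nat_ge v
    exact key n v ⟨hv, by linarith⟩
  have hmono : MonotoneOn h (Set.Ici 1) := by
    refine monotoneOn_of_deriv_nonneg (convex_Ici _)
      (hcont.mono (Set.Ici_subset_Ici.2 zero_le_one)) ?_ ?_
    · rw [interior_Ici]
      exact fun x hx => (hdde x hx).differentiableAt.differentiableWithinAt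
    · rw [interior_Ici]
      intro x hx
      have hx : 1 < x := hx
      rw [(hdde x hx).deriv]
      have := hge (x - 1) (by linarith)
      positivity
  have hle : ∀ v : ℝ, 1 < v → h (v - 1) ≤ h v := by
    intro v hv
    by_cases h2 : v - 1 ≤ 1
    · rw [hinit (v-1) ⟨by linarith, h2⟩]; exact hge v (by linarith)
    · push Not at h2
      exact hmono h2.le hv.le (by linarith)
  have hanti : AntitoneOn (fun v => h v * v ^ (-κ)) (Set.Ici 1) := by
    have hd : ∀ x : ℝ, 1 < x → HasDerivAt (fun v => h v * v ^ (-κ))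
        (κ * h (x - 1) / x * x ^ (-κ) + h x * (-κ * x ^ (-κ - 1))) x := fun x hx =>
      (hdde x hx).mul (Real.hasDerivAt_rpow_const (Or.inl (by linarith)))
    refine antitoneOn_of_deriv_nonpos (convex_Ici _) ?_ ?_ ?_
    · refine (hcont.mono (Set.Ici_subset_Ici.2 zero_le_one)).mul ?_
      intro x hx
      have hx : 1 ≤ x := hx
      exact (Real.continuousAt_rpow_const _ _ (Or.inl (by linarith))).continuousWithinAt
    · rw [interior_Ici]
      exact fun x hx => (hd x hx).differentiableAt.differentiableWithinAt
    · rw [interior_Ici]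
      intro x hx
      have hx : 1 < x := hx
      rw [(hd x hx).deriv, Real.rpow_sub_one (by linarith)]
      have e : κ * h (x - 1) / x * x ^ (-κ) + h x * (-κ * (x ^ (-κ) / x)) =
        -(κ * x ^ (-κ) / x * (h x - h (x-1))) := by ring
      rw [e]
      have := hle x hx
      have h3 : 0 ≤ h x - h (x - 1) := by linarith
      have : 0 ≤ κ * x ^ (-κ) / x * (h x - h (x-1)) := by positivity
      linarith
  intro v hv
  refine ⟨by linarith [hge v hv], ?_⟩
  by_cases hv1 : v ≤ 1
  · rw [hinit v ⟨hv, hv1⟩]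
    exact Real.one_le_rpow (by linarith) hκ.le
  · push Not at hv1
    have h1 := hanti (Set.mem_Ici.2 le_rfl) (Set.mem_Ici.2 hv1.le) hv1.le
    simp only [Real.one_rpow, mul_one, hinit 1 (by simp)] at h1
    rw [Real.rpow_neg hv, ← div_eq_mul_inv, div_le_one (by positivity)] at h1
    exact h1.trans (Real.rpow_le_rpow hv (by linarith) hκ.le)

lemma hk_exp_bound (κ : ℝ) (hκ : 0 < κ) (h : ℝ → ℝ)
    (hb : ∀ v : ℝ, 0 ≤ v → 0 ≤ h v ∧ h v ≤ (1 + v) ^ κ) (ε : ℝ) (hε : 0 < ε) :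
    ∃ C : ℝ, 0 < C ∧ ∀ v : ℝ, 0 ≤ v → (1 + v) * h v ≤ C * Real.exp (ε * v) := by
  have hk1 : 0 < κ + 1 := by linarith
  set δ := ε / (κ + 1) with hδ
  have hδ0 : 0 < δ := by positivity
  refine ⟨(1 + 1/δ) ^ (κ + 1), by positivity, fun v hv => ?_⟩
  have h1 : 1 + v ≤ (1 + 1/δ) * Real.exp (δ * v) := by
    have := Real.add_one_le_exp (δ * v)
    have h2 : (1 + 1/δ) * (δ * v + 1) ≤ (1 + 1/δ) * Real.exp (δ * v) := by gcongr
    have h3 : (1 + 1/δ) * (δ * v + 1) = 1 + v + δ * v + 1/δ := by field_simp; ring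
    have : 0 ≤ δ * v + 1/δ := by positivity
    linarith
  calc (1 + v) * h v ≤ (1 + v) * (1 + v) ^ κ := by gcongr; exact (hb v hv).2
    _ = (1 + v) ^ (κ + 1) := by rw [Real.rpow_add_one (by positivity)]; ring
    _ ≤ ((1 + 1/δ) * Real.exp (δ * v)) ^ (κ + 1) := by gcongr
    _ = _ := by
      rw [Real.mul_rpow (by positivity) (by positivity), ← Real.exp_mul]
      congr 2
      rw [hδ]; field_simp

lemma hk_integrable (f : ℝ → ℂ) (C b : ℝ) (hb : 0 < b)
    (hf : AEStronglyMeasurable f (volume.restrict (Set.Ioi 0)))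
    (hle : ∀ v : ℝ, 0 < v → ‖f v‖ ≤ C * Real.exp (-b * v)) : IntegrableOn f (Set.Ioi 0) := by
  refine Integrable.mono' ((exp_neg_integrableOn_Ioi 0 hb).const_mul C) hf ?_
  exact (ae_restrict_mem measurableSet_Ioi).mono fun v hv => hle v hv

lemma hk_norm_exp (v : ℝ) (s : ℂ) : ‖Complex.exp (-(v:ℂ) * s)‖ = Real.exp (-v * s.re) := by
  rw [Complex.norm_exp]
  simp

lemma hk_ode (κ : ℝ) (h : ℝ → ℝ)
    (hcont : ContinuousOn h (Set.Ici 0))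
    (hinit : ∀ v ∈ Set.Icc (0:ℝ) 1, h v = 1)
    (hdde : ∀ v : ℝ, 1 < v → HasDerivAt h (κ * h (v - 1) / v) v)
    (hpos : ∀ v : ℝ, 0 ≤ v → 0 ≤ h v)
    (hb : ∀ ε : ℝ, 0 < ε → ∃ C : ℝ, 0 < C ∧ ∀ v : ℝ, 0 ≤ v → (1 + v) * h v ≤ C * Real.exp (ε * v))
    (s : ℂ) (hs : 0 < s.re) :
    ∃ D : ℂ, HasDerivAt (fun s : ℂ => ∫ v in Set.Ioi (0:ℝ), Complex.exp (-(v : ℂ) * s) * (h v : ℂ))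
      D s ∧ (∫ v in Set.Ioi (0:ℝ), Complex.exp (-(v : ℂ) * s) * (h v : ℂ)) + s * D =
        - κ * Complex.exp (-s) * ∫ v in Set.Ioi (0:ℝ), Complex.exp (-(v : ℂ) * s) * (h v : ℂ) := by
  have hmeas : AEStronglyMeasurable (fun v => (h v : ℂ)) (volume.restrict (Set.Ioi 0)) :=
    Complex.continuous_ofReal.comp_aestronglyMeasurable
      ((hcont.mono Set.Ioi_subset_Ici_self).aestronglyMeasurable measurableSet_Ioi)
  have hε : 0 < s.re / 4 := by linarith
  obtain ⟨C, hC, hCb⟩ := hb _ hε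
  have main : ∀ x : ℂ, s.re / 2 ≤ x.re → ∀ v : ℝ, 0 ≤ v →
      Real.exp (-v * x.re) * ((1 + v) * h v) ≤ C * Real.exp (-(s.re/4) * v) := by
    intro x hx v hv
    have h1 : Real.exp (-v * x.re) ≤ Real.exp (-v * (s.re/2)) :=
      Real.exp_le_exp.2 (by nlinarith)
    calc _ ≤ Real.exp (-v * (s.re/2)) * (C * Real.exp (s.re/4 * v)) := by
          exact mul_le_mul h1 (hCb v hv) (mul_nonneg (by linarith) (hpos v hv))
            (Real.exp_pos _).le
      _ = C * (Real.exp (-v * (s.re/2)) * Real.exp (s.re/4 * v)) := by ring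
      _ = _ := by rw [← Real.exp_add]; congr 2; ring
  have hnA : ∀ x : ℂ, s.re / 2 ≤ x.re → ∀ v : ℝ, 0 < v →
      ‖Complex.exp (-(v : ℂ) * x) * (h v : ℂ)‖ ≤ C * Real.exp (-(s.re/4) * v) := by
    intro x hx v hv
    refine le_trans ?_ (main x hx v hv.le)
    rw [norm_mul, hk_norm_exp, Complex.norm_real, Real.norm_of_nonneg (hpos v hv.le)]
    gcongr
    nlinarith [hpos v hv.le]
  have hnB : ∀ x : ℂ, s.re / 2 ≤ x.re → ∀ v : ℝ, 0 < v →
      ‖-(v:ℂ) * Complex.exp (-(v : ℂ) * x) * (h v : ℂ)‖ ≤ C * Real.exp (-(s.re/4) * v) := by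
    intro x hx v hv
    refine le_trans ?_ (main x hx v hv.le)
    rw [norm_mul, norm_mul, hk_norm_exp, Complex.norm_real, Real.norm_of_nonneg (hpos v hv.le),
      norm_neg, Complex.norm_real, Real.norm_of_nonneg hv.le, mul_comm v, mul_assoc]
    refine mul_le_mul_of_nonneg_left ?_ (Real.exp_pos _).le
    nlinarith [hpos v hv.le]
  have hmA : ∀ x : ℂ, AEStronglyMeasurable (fun v : ℝ => Complex.exp (-(v : ℂ) * x) * (h v : ℂ))
      (volume.restrict (Set.Ioi 0)) := fun x =>
    (Continuous.aestronglyMeasurable (by fun_prop)).mul hmeas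
  have hmB : ∀ x : ℂ, AEStronglyMeasurable
      (fun v : ℝ => -(v:ℂ) * Complex.exp (-(v : ℂ) * x) * (h v : ℂ))
      (volume.restrict (Set.Ioi 0)) := fun x =>
    (Continuous.aestronglyMeasurable (by fun_prop)).mul hmeas
  have hsr : s.re / 2 ≤ s.re := by linarith
  have hiA := hk_integrable _ _ _ hε (hmA s) (hnA s hsr)
  have hiB := hk_integrable _ _ _ hε (hmB s) (hnB s hsr)
  have hder := (hasDerivAt_integral_of_dominated_loc_of_deriv_le
    (μ := volume.restrict (Set.Ioi (0:ℝ)))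
    (F := fun (x : ℂ) (v : ℝ) => Complex.exp (-(v : ℂ) * x) * (h v : ℂ))
    (F' := fun (x : ℂ) (v : ℝ) => -(v:ℂ) * Complex.exp (-(v : ℂ) * x) * (h v : ℂ))
    (bound := fun v => C * Real.exp (-(s.re/4) * v))
    (Metric.ball_mem_nhds s (show 0 < s.re/2 by linarith))
    (Filter.Eventually.of_forall hmA) hiA (hmB s)
    ((ae_restrict_mem measurableSet_Ioi).mono fun v hv x hx => hnB x (by
      rw [Metric.mem_ball, dist_eq_norm] at hx
      have := (Complex.abs_re_le_norm (x - s)).trans_lt hx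
      rw [Complex.sub_re, abs_lt] at this
      linarith [this.1]) v hv)
    ((exp_neg_integrableOn_Ioi 0 hε).const_mul C)
    (Filter.Eventually.of_forall fun v x _ => by
      have := (((hasDerivAt_id x).const_mul (-(v : ℂ))).cexp).mul_const (h v : ℂ)
      refine this.congr_deriv ?_
      simp only [id]; ring)).2
  refine ⟨_, hder, ?_⟩
  -- translation
  have hpre : (fun x : ℝ => x + 1) ⁻¹' (Set.Ioi 1) = Set.Ioi 0 := by simp
  have hcomp : ∀ v : ℝ, Complex.exp (-((v + 1 : ℝ) : ℂ) * s) * (h (v + 1 - 1) : ℂ) =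
      Complex.exp (-s) * (Complex.exp (-(v : ℂ) * s) * (h v : ℂ)) := by
    intro v
    rw [← mul_assoc, ← Complex.exp_add, add_sub_cancel_right]
    congr 2
    push_cast; ring
  have hiT : IntegrableOn (fun v : ℝ => Complex.exp (-(v : ℂ) * s) * (h (v - 1) : ℂ))
      (Set.Ioi 1) := by
    rw [← (measurePreserving_add_right volume (1:ℝ)).integrableOn_comp_preimage
      (measurableEmbedding_addRight 1), hpre]
    refine (hiA.const_mul (Complex.exp (-s))).congr ?_
    exact Filter.Eventually.of_forall fun v => (hcomp v).symm
  have hT : ∫ v in Set.Ioi (1:ℝ), Complex.exp (-(v : ℂ) * s) * (h (v - 1) : ℂ) =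
      Complex.exp (-s) * ∫ v in Set.Ioi (0:ℝ), Complex.exp (-(v : ℂ) * s) * (h v : ℂ) := by
    rw [← (measurePreserving_add_right volume (1:ℝ)).setIntegral_preimage_emb
      (measurableEmbedding_addRight 1), hpre, ← integral_const_mul]
    exact integral_congr_ae (Filter.Eventually.of_forall hcomp)
  have hiAB : IntegrableOn (fun v : ℝ => Complex.exp (-(v : ℂ) * s) * (h v : ℂ) +
      s * (-(v:ℂ) * Complex.exp (-(v : ℂ) * s) * (h v : ℂ))) (Set.Ioi 0) :=
    hiA.add (hiB.const_mul s)
  have hsplit : (∫ v in Set.Ioi (0:ℝ), Complex.exp (-(v : ℂ) * s) * (h v : ℂ)) +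
      s * (∫ v in Set.Ioi (0:ℝ), -(v:ℂ) * Complex.exp (-(v : ℂ) * s) * (h v : ℂ)) =
      (∫ v in Set.Ioc (0:ℝ) 1, (Complex.exp (-(v : ℂ) * s) * (h v : ℂ) +
        s * (-(v:ℂ) * Complex.exp (-(v : ℂ) * s) * (h v : ℂ)))) +
      ∫ v in Set.Ioi (1:ℝ), (Complex.exp (-(v : ℂ) * s) * (h v : ℂ) +
        s * (-(v:ℂ) * Complex.exp (-(v : ℂ) * s) * (h v : ℂ))) := by
    rw [← integral_const_mul, ← integral_add hiA (hiB.const_mul s),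
      ← Set.Ioc_union_Ioi_eq_Ioi (zero_le_one' ℝ)]
    exact setIntegral_union (Set.Ioc_disjoint_Ioi le_rfl) measurableSet_Ioi
      (hiAB.mono_set Set.Ioc_subset_Ioi_self) (hiAB.mono_set (Set.Ioi_subset_Ioi zero_le_one))
  have hE : ∀ v : ℝ, HasDerivAt (fun v : ℝ => (v:ℂ) * Complex.exp (-(v:ℂ) * s))
      (Complex.exp (-(v : ℂ) * s) + s * (-(v:ℂ) * Complex.exp (-(v : ℂ) * s))) v := by
    intro v
    have h1 := (hasDerivAt_id (v:ℂ)).mul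
      (((hasDerivAt_id (v:ℂ)).neg.mul_const s).cexp)
    refine (h1.comp_ofReal).congr_deriv ?_
    simp only [id, Pi.neg_apply]; ring
  have h01 : ∫ v in Set.Ioc (0:ℝ) 1, (Complex.exp (-(v : ℂ) * s) * (h v : ℂ) +
        s * (-(v:ℂ) * Complex.exp (-(v : ℂ) * s) * (h v : ℂ))) = Complex.exp (-s) := by
    have h1 := intervalIntegral.integral_eq_sub_of_hasDerivAt (a := 0) (b := 1)
      (fun v _ => hE v) (Continuous.intervalIntegrable (by fun_prop) _ _)
    rw [intervalIntegral.integral_of_le zero_le_one] at h1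
    rw [setIntegral_congr_fun (g := fun v : ℝ => Complex.exp (-(v : ℂ) * s) +
      s * (-(v:ℂ) * Complex.exp (-(v : ℂ) * s))) measurableSet_Ioc, h1]
    · simp
    · intro v hv
      simp [hinit v ⟨hv.1.le, hv.2⟩]
  have h1i : ∫ v in Set.Ioi (1:ℝ), ((Complex.exp (-(v : ℂ) * s) * (h v : ℂ) +
        s * (-(v:ℂ) * Complex.exp (-(v : ℂ) * s) * (h v : ℂ))) +
        κ * (Complex.exp (-(v : ℂ) * s) * (h (v - 1) : ℂ))) = 0 - Complex.exp (-s) := by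
    have := integral_Ioi_of_hasDerivAt_of_tendsto (a := 1) (m := 0)
      (f := fun v : ℝ => (v:ℂ) * Complex.exp (-(v:ℂ) * s) * (h v : ℂ))
      (f' := fun v : ℝ => (Complex.exp (-(v : ℂ) * s) * (h v : ℂ) +
        s * (-(v:ℂ) * Complex.exp (-(v : ℂ) * s) * (h v : ℂ))) +
        κ * (Complex.exp (-(v : ℂ) * s) * (h (v - 1) : ℂ))) ?_ ?_ ?_ ?_
    · rw [this]
      simp [hinit 1 (by simp)]
    · refine ContinuousWithinAt.mul (Continuous.continuousWithinAt (by fun_prop)) ?_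
      exact Complex.continuous_ofReal.continuousAt.comp_continuousWithinAt
        ((hcont 1 (by simp)).mono (Set.Ici_subset_Ici.2 zero_le_one))
    · intro v hv
      have hv : 1 < v := hv
      have hvc : (v:ℂ) ≠ 0 := by exact_mod_cast (by linarith : v ≠ 0)
      refine ((hE v).mul (hdde v hv).ofReal_comp).congr_deriv ?_
      push_cast
      field_simp
    · exact (hiAB.mono_set (Set.Ioi_subset_Ioi zero_le_one)).add (hiT.const_mul _)
    · have hz : Filter.Tendsto (fun v : ℝ => C * Real.exp (-(s.re/4) * v)) Filter.atTop
          (nhds 0) := by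
        have : Filter.Tendsto (fun v : ℝ => -(s.re/4) * v) Filter.atTop Filter.atBot :=
          Filter.tendsto_id.const_mul_atTop_of_neg (by linarith)
        simpa using (Real.tendsto_exp_atBot.comp this).const_mul C
      refine squeeze_zero_norm' ?_ hz
      filter_upwards [Filter.eventually_gt_atTop 0] with v hv
      have := hnB s hsr v hv
      rwa [neg_mul, neg_mul, norm_neg] at this
  rw [integral_add (hiAB.mono_set (Set.Ioi_subset_Ioi zero_le_one)) (hiT.const_mul _),
    integral_const_mul, hT] at h1i
  rw [hsplit, h01]
  linear_combination h1i

lemma hk_lim (h : ℝ → ℝ)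
    (hcont : ContinuousOn h (Set.Ici 0))
    (hinit : ∀ v ∈ Set.Icc (0:ℝ) 1, h v = 1)
    (κ : ℝ) (hκ : 0 < κ) (hb : ∀ v : ℝ, 0 ≤ v → 0 ≤ h v ∧ h v ≤ (1 + v) ^ κ) :
    Filter.Tendsto (fun x : ℝ => (x:ℂ) *
      ∫ v in Set.Ioi (0:ℝ), Complex.exp (-(v : ℂ) * (x:ℂ)) * (h v : ℂ)) Filter.atTop (nhds 1) := by
  have hval : ∫ u in Set.Ioi (0:ℝ), ((Real.exp (-u) : ℝ) : ℂ) = 1 := by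
    rw [integral_complex_ofReal, integral_exp_neg_Ioi_zero]; simp
  have hkey : Filter.Tendsto (fun x : ℝ => ∫ u in Set.Ioi (0:ℝ),
      ((Real.exp (-u) : ℝ) : ℂ) * (h (x⁻¹ * u) : ℂ)) Filter.atTop
      (nhds (∫ u in Set.Ioi (0:ℝ), ((Real.exp (-u) : ℝ) : ℂ))) := by
    obtain ⟨C, hC, hCb⟩ := hk_exp_bound κ hκ (fun v => (1 + v) ^ κ)
      (fun v hv => ⟨by positivity, le_rfl⟩) (1/2) (by norm_num)
    refine tendsto_integral_filter_of_dominated_convergence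
      (fun u => C * Real.exp (-(1/2) * u)) ?_ ?_
      ((exp_neg_integrableOn_Ioi 0 (by norm_num)).const_mul C) ?_
    · filter_upwards [Filter.eventually_gt_atTop 0] with x hx
      refine ContinuousOn.aestronglyMeasurable ?_ measurableSet_Ioi
      refine ContinuousOn.mul (Continuous.continuousOn (by fun_prop)) ?_
      refine Complex.continuous_ofReal.comp_continuousOn ?_
      refine hcont.comp (Continuous.continuousOn (by fun_prop)) ?_
      intro u hu
      have hu : 0 < u := hu
      exact Set.mem_Ici.2 (by positivity)
    · filter_upwards [Filter.eventually_ge_atTop 1] with x hx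
      refine (ae_restrict_mem measurableSet_Ioi).mono fun u hu => ?_
      have hu : 0 < u := hu
      have hx0 : 0 < x := by linarith
      have hxu : 0 ≤ x⁻¹ * u := by positivity
      have hxu' : x⁻¹ * u ≤ u := by
        have := inv_le_one_of_one_le₀ hx
        nlinarith
      rw [norm_mul, Complex.norm_real, Complex.norm_real, Real.norm_of_nonneg (hb _ hxu).1,
        Real.norm_of_nonneg (Real.exp_pos _).le]
      have h1 : h (x⁻¹ * u) ≤ C * Real.exp (1/2 * u) := by
        refine (hb _ hxu).2.trans (le_trans ?_ (hCb u hu.le))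
        refine (Real.rpow_le_rpow (by positivity) (by linarith : 1 + x⁻¹ * u ≤ 1 + u) hκ.le).trans ?_
        have : 0 ≤ (1 + u) ^ κ := by positivity
        nlinarith
      calc _ ≤ Real.exp (-u) * (C * Real.exp (1/2 * u)) := by gcongr
        _ = C * (Real.exp (-u) * Real.exp (1/2 * u)) := by ring
        _ = _ := by rw [← Real.exp_add]; congr 2; ring
    · refine (ae_restrict_mem measurableSet_Ioi).mono fun u hu => ?_
      have hu : 0 < u := hu
      refine tendsto_const_nhds.congr' ?_
      filter_upwards [Filter.eventually_ge_atTop u] with x hx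
      have hx0 : 0 < x := by linarith
      rw [hinit _ ⟨by positivity, ?_⟩]
      · simp
      · rw [inv_mul_le_iff₀ hx0]; linarith
  rw [hval] at hkey
  refine hkey.congr' ?_
  filter_upwards [Filter.eventually_gt_atTop 0] with x hx
  have := integral_comp_mul_left_Ioi (fun u : ℝ => ((Real.exp (-u) : ℝ) : ℂ) * (h (x⁻¹ * u) : ℂ))
    0 hx
  rw [mul_zero] at this
  have hxc : (x:ℂ) ≠ 0 := by exact_mod_cast hx.ne'
  have h2 : ∀ v : ℝ, ((Real.exp (-(x * v)) : ℝ) : ℂ) * (h (x⁻¹ * (x * v)) : ℂ) =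
      Complex.exp (-(v : ℂ) * (x:ℂ)) * (h v : ℂ) := by
    intro v
    rw [inv_mul_cancel_left₀ hx.ne']
    push_cast
    congr 2; ring
  simp only [h2] at this
  rw [this, Complex.real_smul]
  push_cast
  rw [mul_inv_cancel_left₀ hxc]

/-- The Laplace transform of `h_κ`: for `Re s > 0`,
`ĥ_κ(s) = 1 / (s^{κ+1} ϱ̂(s)^κ)` where `ϱ̂(s) = e^{γ + I(−s)}`. -/
theorem hkappa_laplace (κ : ℝ) (hκ : 0 < κ) (h : ℝ → ℝ)
    (hcont : ContinuousOn h (Set.Ici 0))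
    (hinit : ∀ v ∈ Set.Icc (0:ℝ) 1, h v = 1)
    (hdde : ∀ v : ℝ, 1 < v → HasDerivAt h (κ * h (v - 1) / v) v)
    (I : ℂ → ℂ)
    (hI : ∀ s : ℂ, I s = ∫ t in (0:ℝ)..1, (Complex.exp ((t : ℂ) * s) - 1) / (t : ℂ)) :
    ∀ s : ℂ, 0 < s.re →
      ∫ v in Set.Ioi (0:ℝ), Complex.exp (-(v : ℂ) * s) * (h v : ℂ)
        = 1 / (s ^ ((κ : ℂ) + 1) *
            Complex.exp ((κ : ℂ) * ((Real.eulerMascheroniConstant : ℂ) + I (-s)))) := by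
  have hb := hk_bounds κ hκ h hcont hinit hdde
  have hode := hk_ode κ h hcont hinit hdde (fun v hv => (hb v hv).1) (hk_exp_bound κ hκ h hb)
  have hlim := hk_lim h hcont hinit κ hκ hb
  set G : ℂ → ℂ := fun s => ∫ v in Set.Ioi (0:ℝ), Complex.exp (-(v : ℂ) * s) * (h v : ℂ) with hG
  change ∀ s : ℂ, 0 < s.re → ∃ D, HasDerivAt G D s ∧
    G s + s * D = -κ * Complex.exp (-s) * G s at hode
  change Filter.Tendsto (fun x : ℝ => (x:ℂ) * G x) Filter.atTop (nhds 1) at hlim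
  have hI' : I = fun s => ∫ t in (0:ℝ)..1, (Complex.exp ((t : ℂ) * s) - 1) / (t : ℂ) := funext hI
  set γ : ℂ := (Real.eulerMascheroniConstant : ℂ) with hγ
  set Φ : ℂ → ℂ := fun s => s * G s * Complex.exp (κ * (Complex.log s + (γ + I (-s)))) with hΦ
  have hΦd : ∀ s : ℂ, 0 < s.re → HasDerivAt Φ 0 s := by
    intro s hs
    obtain ⟨D, hD, hDe⟩ := hode s hs
    have hs0 : s ≠ 0 := by rintro rfl; simp at hs
    have hId : HasDerivAt (fun s => I (-s)) ((Complex.exp (-s) - 1) / s) s := by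
      have h1 := hk_J_deriv (-s)
      rw [← hI'] at h1
      refine (h1.comp s (hasDerivAt_neg s)).congr_deriv ?_
      have := integral_exp_mul_complex (a := 0) (b := 1) (c := -s) (by simpa using hs0)
      simp only [mul_comm (-s)] at this
      rw [this]
      field_simp
      simp
    have h2 := (((hasDerivAt_id s).mul hD).mul
      ((((Complex.hasDerivAt_log (Or.inl hs)).add (hId.const_add γ)).const_mul (κ:ℂ)).cexp))
    refine h2.congr_deriv ?_
    simp only [id, Pi.mul_apply, Pi.add_apply]
    have e : s⁻¹ + (Complex.exp (-s) - 1) / s = Complex.exp (-s) / s := by field_simp; ring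
    rw [e, one_mul, hDe]
    field_simp
    ring
  have hopen : IsOpen {s : ℂ | 0 < s.re} := Complex.continuous_re.isOpen_preimage _ isOpen_Ioi
  have hconst : ∀ s t : ℂ, 0 < s.re → 0 < t.re → Φ s = Φ t := by
    intro s t hs ht
    exact hopen.is_const_of_deriv_eq_zero (convex_halfSpace_re_gt 0).isPreconnected
      (fun z hz => (hΦd z hz).differentiableAt.differentiableWithinAt)
      (fun z hz => (hΦd z hz).deriv) hs ht
  have hΦlim : Filter.Tendsto (fun x : ℝ => Φ x) Filter.atTop (nhds 1) := by
    have h1 := (hk_J_lim.const_add γ).const_mul (κ:ℂ)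
    have h2 := hlim.mul ((Complex.continuous_exp.tendsto _).comp h1)
    simp only [← hγ, add_neg_cancel, mul_zero, Complex.exp_zero, mul_one] at h2
    refine h2.congr' ?_
    filter_upwards [Filter.eventually_gt_atTop 0] with x hx
    simp only [hΦ, Function.comp, hI, Complex.ofReal_log hx.le]
    congr 2; ring
  intro s hs
  have hs0 : s ≠ 0 := by rintro rfl; simp at hs
  have hone : Φ s = 1 := by
    refine tendsto_nhds_unique (tendsto_const_nhds.congr' ?_) hΦlim
    filter_upwards [Filter.eventually_gt_atTop 0] with x hx
    exact hconst s x hs (by simpa using hx)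
  change G s = _
  have h3 : s ^ ((κ : ℂ) + 1) * Complex.exp ((κ : ℂ) * (γ + I (-s))) =
      s * Complex.exp (κ * (Complex.log s + (γ + I (-s)))) := by
    rw [Complex.cpow_add _ _ hs0, Complex.cpow_one, Complex.cpow_def_of_ne_zero hs0,
      mul_add (κ : ℂ) (Complex.log s), Complex.exp_add, mul_comm (Complex.log s)]
    ring
  rw [h3, eq_div_iff (mul_ne_zero hs0 (Complex.exp_ne_zero _)), ← hone]
  simp only [hΦ]
  ring
end

section
/- For every κ > 0 with ν = ⌊κ⌋ and ϑ = κ − ν ∈ [0,1), there exists a continuous function φ_κ on (0,∞), differentiable on (1,∞), solving v·φ_κ'(v) + ϑ·φ_κ(v) − κ·φ_κ(v−1) = 0 for v > 1, with φ_κ(v) = v^{−ϑ}/Γ(1−ϑ) on (0,1], and its Laplace transform satisfies φ̂_κ(s) = 1/(s^{ν+1} ϱ̂(s)^κ) for Re s > 0. -/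
open MeasureTheory

noncomputable def Wk (θ : ℝ) : ℝ → ℝ :=
  (Set.Ioi (1:ℝ)).indicator (fun u => (max u 1) ^ (θ - 1) * (u - 1) ^ (-θ))

lemma Wk_int (θ : ℝ) (h1 : θ < 1) (a b : ℝ) :
    IntervalIntegrable (Wk θ) volume a b := by
  have h : IntervalIntegrable (fun u : ℝ => (max u 1) ^ (θ - 1) * (u - 1) ^ (-θ)) volume a b := by
    apply IntervalIntegrable.continuousOn_mul
    · have := (intervalIntegral.intervalIntegrable_rpow' (a := a - 1) (b := b - 1) (r := -θ)
        (by linarith)).comp_sub_right 1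
      simpa using this
    · apply Continuous.continuousOn
      apply Continuous.rpow_const (by fun_prop)
      intro x
      left
      have := le_max_right x 1
      linarith
  rw [intervalIntegrable_iff] at h ⊢
  exact h.indicator measurableSet_Ioi

lemma Wk_zero (θ u : ℝ) (hu : u ≤ 1) : Wk θ u = 0 := by
  unfold Wk; simp [hu]

lemma Wk_eq (θ u : ℝ) (hu : 1 < u) : Wk θ u = u ^ (θ - 1) * (u - 1) ^ (-θ) := by
  unfold Wk; simp [hu, max_eq_left hu.le]

lemma Wk_nonneg (θ u : ℝ) : 0 ≤ Wk θ u := by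
  rcases le_or_gt u 1 with h | h
  · rw [Wk_zero _ _ h]
  · rw [Wk_eq _ _ h]
    have : 0 < u - 1 := by linarith
    positivity

lemma Wk_cont (θ u : ℝ) (hu : 1 < u) : ContinuousAt (Wk θ) u := by
  have h : ContinuousAt (fun u : ℝ => u ^ (θ - 1) * (u - 1) ^ (-θ)) u := by
    apply ContinuousAt.mul
    · exact continuousAt_id.rpow_const (Or.inl (by simp; linarith))
    · exact (continuousAt_id.sub continuousAt_const).rpow_const (Or.inl (by simp; linarith))
  apply h.congr
  filter_upwards [lt_mem_nhds hu] with x hx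
  rw [Wk_eq _ _ hx]

noncomputable def Gk (θ v : ℝ) : ℝ := ∫ u in (1:ℝ)..v, Wk θ u

lemma Gk_cont (θ : ℝ) (h1 : θ < 1) : Continuous (Gk θ) :=
  intervalIntegral.continuous_primitive (Wk_int θ h1) 1

lemma Gk_zero (θ v : ℝ) (hv : v ≤ 1) : Gk θ v = 0 := by
  unfold Gk
  rw [intervalIntegral.integral_congr (g := fun _ => 0)]
  · simp
  · intro u hu
    rw [Set.uIcc_of_ge hv] at hu
    exact Wk_zero _ _ hu.2

lemma Gk_mono (θ : ℝ) (h1 : θ < 1) : Monotone (Gk θ) := by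
  intro a b hab
  have : Gk θ b - Gk θ a = ∫ u in a..b, Wk θ u :=
    intervalIntegral.integral_interval_sub_left (Wk_int θ h1 _ _) (Wk_int θ h1 _ _)
  have h2 : 0 ≤ ∫ u in a..b, Wk θ u :=
    intervalIntegral.integral_nonneg hab (fun u _ => Wk_nonneg θ u)
  linarith

/-- general derivative of primitive of `W * f(·-1)` -/
lemma prim_deriv (θ : ℝ) (h1 : θ < 1) (f : ℝ → ℝ) (hf : Continuous f) (v : ℝ) (hv : 1 < v) :
    HasDerivAt (fun v => ∫ u in (1:ℝ)..v, Wk θ u * f u) (Wk θ v * f v) v := by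
  have hi : ∀ a b, IntervalIntegrable (fun u => Wk θ u * f u) volume a b := fun a b =>
    (Wk_int θ h1 a b).mul_continuousOn hf.continuousOn
  apply intervalIntegral.integral_hasDerivAt_right (hi _ _)
  · refine ⟨Set.Ioo 0 (v+1), Ioo_mem_nhds (by linarith) (by linarith), ?_⟩
    have := (hi 0 (v+1)).1.aestronglyMeasurable
    exact this.mono_measure (Measure.restrict_mono Set.Ioo_subset_Ioc_self le_rfl)
  · exact (Wk_cont θ v hv).mul hf.continuousAt

lemma Gk_le (θ : ℝ) (h1 : θ < 1) (v : ℝ) (hv : 0 ≤ v) :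
    Gk θ v ≤ Gk θ 2 + Real.log (1 + v) := by
  have hl : 0 ≤ Real.log (1 + v) := Real.log_nonneg (by linarith)
  rcases le_or_gt v 2 with h | h
  · have := Gk_mono θ h1 h
    linarith
  · have : Gk θ v - Gk θ 2 = ∫ u in (2:ℝ)..v, Wk θ u :=
      intervalIntegral.integral_interval_sub_left (Wk_int θ h1 _ _) (Wk_int θ h1 _ _)
    have hc : ContinuousOn (fun u : ℝ => (u-1)⁻¹) (Set.uIcc 2 v) := by
      apply ContinuousOn.inv₀ (by fun_prop)
      intro x hx
      rw [Set.uIcc_of_le h.le] at hx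
      have := hx.1
      linarith
    have h2 : ∫ u in (2:ℝ)..v, Wk θ u ≤ ∫ u in (2:ℝ)..v, (u-1)⁻¹ := by
      apply intervalIntegral.integral_mono_on h.le (Wk_int θ h1 _ _) hc.intervalIntegrable
      intro u hu
      have hu2 := hu.1
      have hp : 0 < u - 1 := by linarith
      rw [Wk_eq _ _ (by linarith)]
      calc u ^ (θ - 1) * (u - 1) ^ (-θ) ≤ (u-1) ^ (θ - 1) * (u - 1) ^ (-θ) := by
            apply mul_le_mul_of_nonneg_right _ (by positivity)
            apply Real.rpow_le_rpow_of_nonpos hp (by linarith) (by linarith)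
        _ = (u-1)⁻¹ := by
            rw [← Real.rpow_add hp, ← Real.rpow_neg_one]; congr 1; ring
    have h3 : ∫ u in (2:ℝ)..v, (u-1)⁻¹ = Real.log (v - 1) := by
      rw [intervalIntegral.integral_comp_sub_right (fun u => u⁻¹) 1, integral_inv_of_pos (by norm_num) (by linarith)]
      norm_num
    have h4 : Real.log (v - 1) ≤ Real.log (1 + v) := Real.log_le_log (by linarith) (by linarith)
    linarith

lemma exp_Gk (θ κ c : ℝ) (h1 : θ < 1) (v : ℝ) :
    c + κ * ∫ u in (1:ℝ)..v, Wk θ u * (c * Real.exp (κ * Gk θ u)) = c * Real.exp (κ * Gk θ v) := by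
  rcases le_or_gt v 1 with h | h
  · rw [Gk_zero _ _ h, intervalIntegral.integral_congr (g := fun _ => 0)]
    · simp
    · intro u hu
      rw [Set.uIcc_of_ge h] at hu
      simp [Wk_zero _ _ hu.2]
  · have hc := Gk_cont θ h1
    have : ∫ u in (1:ℝ)..v, κ * (Wk θ u * (c * Real.exp (κ * Gk θ u))) =
        c * Real.exp (κ * Gk θ v) - c * Real.exp (κ * Gk θ 1) := by
      apply intervalIntegral.integral_eq_sub_of_hasDerivAt_of_le h.le (f := fun v => c * Real.exp (κ * Gk θ v))
      · fun_prop
      · intro x hx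
        have hG : HasDerivAt (Gk θ) (Wk θ x) x := by
          have := prim_deriv θ h1 (fun _ => 1) continuous_const x hx.1
          simp only [mul_one] at this
          exact this
        have := ((hG.const_mul κ).exp.const_mul c)
        refine this.congr_deriv ?_
        ring
      · exact ((Wk_int θ h1 _ _).mul_continuousOn (by fun_prop)).const_mul κ
    rw [intervalIntegral.integral_const_mul] at this
    rw [this, Gk_zero _ 1 le_rfl]
    simp

noncomputable def Pk (θ κ c : ℝ) : ℕ → ℝ → ℝ
  | 0 => fun _ => c
  | n+1 => fun v => c + κ * ∫ u in (1:ℝ)..v, Wk θ u * Pk θ κ c n (u - 1)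

lemma Pk_apply (θ κ c : ℝ) (n : ℕ) (v : ℝ) : Pk θ κ c (n+1) v =
    c + κ * ∫ u in (1:ℝ)..v, Wk θ u * Pk θ κ c n (u - 1) := rfl

lemma Pk_cont (θ κ c : ℝ) (h1 : θ < 1) (n : ℕ) : Continuous (Pk θ κ c n) := by
  induction n with
  | zero => exact continuous_const
  | succ n ih =>
    unfold Pk
    refine continuous_const.add (continuous_const.mul ?_)
    apply intervalIntegral.continuous_primitive
    intro a b
    exact (Wk_int θ h1 a b).mul_continuousOn (ih.comp (by fun_prop)).continuousOn

lemma T_congr (θ : ℝ) (f g : ℝ → ℝ) (v : ℝ) (h : ∀ u, 1 < u → u ≤ v → f u = g u) :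
    ∫ u in (1:ℝ)..v, Wk θ u * f u = ∫ u in (1:ℝ)..v, Wk θ u * g u := by
  apply intervalIntegral.integral_congr
  intro u hu
  rcases le_or_gt u 1 with h' | h'
  · simp [Wk_zero _ _ h']
  · have : u ≤ v := by
      rw [Set.mem_uIcc] at hu
      rcases hu with hu | hu
      · exact hu.2
      · linarith [hu.2]
    simp [h u h' this]

lemma T_zero (θ : ℝ) (f : ℝ → ℝ) (v : ℝ) (h : v ≤ 1) :
    ∫ u in (1:ℝ)..v, Wk θ u * f u = 0 := by
  rw [T_congr θ f (fun _ => 0) v (fun u _ _ => by linarith)]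
  simp

lemma Pk_succ (θ κ c : ℝ) (n : ℕ) (v : ℝ) (hv : v ≤ n + 1) :
    Pk θ κ c (n+1) v = Pk θ κ c n v := by
  induction n generalizing v with
  | zero =>
    have hv' : v ≤ 1 := by simpa using hv
    rw [Pk_apply, T_zero _ _ _ hv']
    simp [Pk]
  | succ n ih =>
    rw [Pk_apply, Pk_apply θ κ c n]
    congr 2
    apply T_congr
    intro u hu huv
    apply ih
    push_cast at hv
    linarith

lemma Pk_agree (θ κ c : ℝ) (n k : ℕ) (v : ℝ) (hv : v ≤ n + 1) :
    Pk θ κ c (n+k) v = Pk θ κ c n v := by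
  induction k with
  | zero => rfl
  | succ k ih =>
    rw [← ih, ← add_assoc]
    apply Pk_succ
    push_cast
    have : (0:ℝ) ≤ k := k.cast_nonneg
    linarith

lemma Pk_agree' (θ κ c : ℝ) (n m : ℕ) (v : ℝ) (hn : v ≤ n + 1) (hm : v ≤ m + 1) :
    Pk θ κ c n v = Pk θ κ c m v := by
  rcases le_total n m with h | h
  · obtain ⟨k, rfl⟩ := Nat.exists_eq_add_of_le h
    exact (Pk_agree _ _ _ _ _ _ hn).symm
  · obtain ⟨k, rfl⟩ := Nat.exists_eq_add_of_le h
    exact (Pk_agree _ _ _ _ _ _ hm)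

lemma Pk_bd (θ κ c : ℝ) (h1 : θ < 1) (hκ : 0 < κ) (hc : 0 < c) (n : ℕ) (v : ℝ) :
    0 ≤ Pk θ κ c n v ∧ Pk θ κ c n v ≤ c * Real.exp (κ * Gk θ v) := by
  have hG0 : ∀ v, 0 ≤ Gk θ v := by
    intro v
    rcases le_total v 1 with h | h
    · rw [Gk_zero _ _ h]
    · have := Gk_mono θ h1 h
      rwa [Gk_zero _ _ le_rfl] at this
  induction n generalizing v with
  | zero =>
    refine ⟨hc.le, ?_⟩
    have : 1 ≤ Real.exp (κ * Gk θ v) := Real.one_le_exp (mul_nonneg hκ.le (hG0 v))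
    simp only [Pk]
    nlinarith
  | succ n ih =>
    rw [Pk_apply]
    rcases le_total v 1 with h | h
    · rw [T_zero _ _ _ h, Gk_zero _ _ h]
      simp [hc.le]
    · constructor
      · have := intervalIntegral.integral_nonneg (μ := volume) h
          (fun u _ => mul_nonneg (Wk_nonneg θ u) (ih (u-1)).1)
        positivity
      · rw [← exp_Gk θ κ c h1 v]
        gcongr
        have hPc := Pk_cont θ κ c h1 n
        have hc := Gk_cont θ h1
        apply intervalIntegral.integral_mono_on h
        · exact (Wk_int θ h1 _ _).mul_continuousOn (by fun_prop)
        · exact (Wk_int θ h1 _ _).mul_continuousOn (by fun_prop)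
        · intro u hu
          apply mul_le_mul_of_nonneg_left _ (Wk_nonneg θ u)
          refine (ih (u-1)).2.trans ?_
          gcongr
          exact Gk_mono θ h1 (by linarith)

lemma exists_psi (θ κ c : ℝ) (h1 : θ < 1) (hκ : 0 < κ) (hc : 0 < c) :
    ∃ ψ : ℝ → ℝ, Continuous ψ ∧ (∀ v ≤ 1, ψ v = c) ∧
      (∀ v, 1 < v → HasDerivAt ψ (κ * (v ^ (θ - 1) * (v - 1) ^ (-θ) * ψ (v - 1))) v) ∧
      (∀ v, 0 ≤ ψ v) ∧ ∃ A, 0 ≤ A ∧ ∀ v, 0 ≤ v → ψ v ≤ A * (1 + v) ^ κ := by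
  let ψ : ℝ → ℝ := fun v => Pk θ κ c ⌈v⌉₊ v
  have hψ : ∀ (n : ℕ) (v : ℝ), v ≤ n + 1 → ψ v = Pk θ κ c n v := by
    intro n v hv
    exact Pk_agree' _ _ _ _ _ _ (by linarith [Nat.le_ceil v]) hv
  have hcont : Continuous ψ := by
    rw [continuous_iff_continuousAt]
    intro v
    apply ((Pk_cont θ κ c h1 ⌈v⌉₊).continuousAt).congr
    filter_upwards [gt_mem_nhds (show v < v + 1 by linarith)] with x hx
    exact (hψ _ _ (by linarith [Nat.le_ceil v])).symm
  have hT : ∀ v, ψ v = c + κ * ∫ u in (1:ℝ)..v, Wk θ u * ψ (u - 1) := by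
    intro v
    rw [hψ (⌈v⌉₊ + 1) v (by push_cast; linarith [Nat.le_ceil v]), Pk_apply]
    congr 2
    apply T_congr
    intro u hu huv
    exact (hψ _ _ (by linarith [Nat.le_ceil v])).symm
  refine ⟨ψ, hcont, ?_, ?_, fun v => (Pk_bd θ κ c h1 hκ hc _ v).1,
    c * Real.exp (κ * Gk θ 2), by positivity, ?_⟩
  · intro v hv
    rw [hψ 0 v (by simpa using hv)]; rfl
  · intro v hv
    have := ((prim_deriv θ h1 (fun u => ψ (u-1)) (by fun_prop) v hv).const_mul κ).const_add c
    rw [Wk_eq _ _ hv] at this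
    rw [← funext hT] at this
    exact this
  · intro v hv
    refine (Pk_bd θ κ c h1 hκ hc _ v).2.trans ?_
    rw [mul_assoc, Real.rpow_def_of_pos (by linarith), ← Real.exp_add]
    gcongr
    have := Gk_le θ h1 v hv
    nlinarith

open Filter Topology in
lemma log_exp_integral : IntegrableOn (fun t : ℝ => Real.log t * Real.exp (-t)) (Set.Ioi 0) ∧
    ∫ t in Set.Ioi (0:ℝ), Real.log t * Real.exp (-t) = -Real.eulerMascheroniConstant := by
  have h1 := Complex.hasDerivAt_GammaIntegral (s := 1) (by simp)
  have h2 : HasDerivAt Complex.GammaIntegral (-(Real.eulerMascheroniConstant : ℂ)) 1 := by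
    apply Complex.hasDerivAt_Gamma_one.congr_of_eventuallyEq
    have : ∀ᶠ s : ℂ in 𝓝 1, 0 < s.re :=
      (Complex.continuous_re.isOpen_preimage _ isOpen_Ioi).mem_nhds (by simp)
    filter_upwards [this] with a ha using (Complex.Gamma_eq_integral ha).symm
  have h3 := h1.unique h2
  have h4 : ∫ t in Set.Ioi (0:ℝ), Real.log t * Real.exp (-t) = -Real.eulerMascheroniConstant := by
    simp only [sub_self, Complex.cpow_zero, one_mul] at h3
    norm_cast at h3
  refine ⟨?_, h4⟩
  by_contra hc
  rw [integral_undef hc] at h4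
  have := Real.one_half_lt_eulerMascheroniConstant
  linarith

lemma expm1_cont : Continuous (dslope (fun u : ℝ => Real.exp (-u) - 1) 0) := by
  rw [continuous_iff_continuousAt]
  intro x
  by_cases h : x = 0
  · subst h
    rw [continuousAt_dslope_same]
    fun_prop
  · rw [continuousAt_dslope_of_ne h]
    fun_prop

lemma expm1_eq (u : ℝ) (hu : u ≠ 0) :
    dslope (fun u : ℝ => Real.exp (-u) - 1) 0 u = (Real.exp (-u) - 1) / u := by
  rw [dslope_of_ne _ hu, slope_def_field]; simp

lemma J_formula (x : ℝ) (hx : 0 < x) : ∫ t in (0:ℝ)..1, (Real.exp (-(t * x)) - 1) / t =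
    (∫ t in (0:ℝ)..x, Real.log t * Real.exp (-t)) + (Real.exp (-x) - 1) * Real.log x := by
  have h1 : ∫ t in (0:ℝ)..1, (Real.exp (-(t * x)) - 1) / t =
      ∫ u in (0:ℝ)..x, (Real.exp (-u) - 1) / u := by
    have := intervalIntegral.integral_comp_mul_right (a := 0) (b := 1)
      (fun u => (Real.exp (-u) - 1) / u) hx.ne'
    simp only [zero_mul, one_mul, smul_eq_mul] at this
    have h2 : ∫ u in (0:ℝ)..x, (Real.exp (-u) - 1) / u =
      x * ∫ t in (0:ℝ)..1, (Real.exp (-(t * x)) - 1) / (t * x) := by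
      rw [this]; field_simp
    rw [h2, ← intervalIntegral.integral_const_mul]
    apply intervalIntegral.integral_congr
    intro t _
    simp only
    by_cases ht : t = 0
    · simp [ht]
    · field_simp
  rw [h1]
  have hli : ∀ a b : ℝ, IntervalIntegrable (fun t => Real.log t * Real.exp (-t)) volume a b := by
    intro a b
    exact intervalIntegral.intervalIntegrable_log'.mul_continuousOn (by fun_prop)
  have hD : ∀ u : ℝ, (Real.exp (-u) - 1) * Real.log u =
      dslope (fun u : ℝ => Real.exp (-u) - 1) 0 u * (u * Real.log u) := by
    intro u
    by_cases hu : u = 0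
    · simp [hu]
    · rw [expm1_eq u hu]; field_simp
  have := intervalIntegral.integral_eq_sub_of_hasDerivAt_of_le hx.le
    (f := fun x => (∫ t in (0:ℝ)..x, Real.log t * Real.exp (-t)) + (Real.exp (-x) - 1) * Real.log x)
    (f' := fun u => (Real.exp (-u) - 1) / u) ?_ ?_ ?_
  · rw [this]; simp
  · apply Continuous.continuousOn
    apply Continuous.add
    · exact intervalIntegral.continuous_primitive hli 0
    · simp only [hD]
      exact expm1_cont.mul Real.continuous_mul_log
  · intro u hu
    have hu0 : u ≠ 0 := hu.1.ne'
    have a1 : HasDerivAt (fun x => ∫ t in (0:ℝ)..x, Real.log t * Real.exp (-t))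
        (Real.log u * Real.exp (-u)) u := by
      apply intervalIntegral.integral_hasDerivAt_right (hli _ _)
      · refine (Measurable.aestronglyMeasurable ?_).stronglyMeasurableAtFilter
        fun_prop
      · exact (Real.continuousAt_log hu0).mul (by fun_prop)
    have a2 := (((hasDerivAt_id u).neg.exp).sub_const 1).mul (Real.hasDerivAt_log hu0)
    refine (a1.add a2).congr_deriv ?_
    simp
    field_simp
    ring
  · apply (expm1_cont.intervalIntegrable 0 x).congr
    intro u hu
    rw [Set.uIoc_of_le hx.le] at hu
    exact expm1_eq u hu.1.ne'

open Filter Topology in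
lemma J_tendsto : Tendsto (fun x : ℝ => (∫ t in (0:ℝ)..1, (Real.exp (-(t * x)) - 1) / t) + Real.log x)
    atTop (𝓝 (-Real.eulerMascheroniConstant)) := by
  have h1 := intervalIntegral_tendsto_integral_Ioi (0:ℝ) log_exp_integral.1 tendsto_id
  rw [log_exp_integral.2] at h1
  have h2 : Tendsto (fun x : ℝ => Real.exp (-x) * Real.log x) atTop (𝓝 0) := by
    have h3 : Tendsto (fun x : ℝ => Real.exp (-x) * x) atTop (𝓝 0) := by
      have := Real.tendsto_pow_mul_exp_neg_atTop_nhds_zero 1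
      simpa [mul_comm] using this
    refine squeeze_zero' ?_ ?_ h3
    · filter_upwards [eventually_ge_atTop 1] with x hx
      exact mul_nonneg (Real.exp_pos _).le (Real.log_nonneg hx)
    · filter_upwards [eventually_ge_atTop 1] with x hx
      gcongr
      exact Real.log_le_self (by linarith)
  have h3 := h1.add h2
  rw [add_zero] at h3
  refine h3.congr' ?_
  filter_upwards [eventually_gt_atTop 0] with x hx
  rw [J_formula x hx]
  simp only [id]
  ring

lemma I_real (x : ℝ) : ∫ t in (0:ℝ)..1, (Complex.exp ((t : ℂ) * (-(x:ℂ))) - 1) / (t : ℂ) =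
    ((∫ t in (0:ℝ)..1, (Real.exp (-(t * x)) - 1) / t : ℝ) : ℂ) := by
  rw [← intervalIntegral.integral_ofReal]
  congr 1
  ext t
  push_cast
  congr 3
  ring

open Topology in
lemma I_deriv (s : ℂ) (hs : s ≠ 0) :
    HasDerivAt (fun s : ℂ => ∫ t in (0:ℝ)..1, (Complex.exp ((t : ℂ) * s) - 1) / (t : ℂ))
      ((Complex.exp s - 1) / s) s := by
  have hval : ∫ t in (0:ℝ)..1, Complex.exp ((t:ℂ) * s) = (Complex.exp s - 1) / s := by
    have := integral_exp_mul_complex (a := 0) (b := 1) hs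
    simpa [mul_comm] using this
  rw [← hval]
  have hc : ∀ s : ℂ, Continuous (dslope (fun t : ℝ => Complex.exp ((t:ℂ) * s) - 1) 0) := by
    intro s
    rw [continuous_iff_continuousAt]
    intro x
    by_cases h : x = 0
    · subst h
      rw [continuousAt_dslope_same]
      have : HasDerivAt (fun t : ℝ => Complex.exp ((t:ℂ) * s) - 1) _ 0 :=
        (((Complex.ofRealCLM.hasDerivAt (x := 0)).mul_const s).cexp).sub_const 1
      exact this.differentiableAt
    · rw [continuousAt_dslope_of_ne h]
      fun_prop
  refine (intervalIntegral.hasDerivAt_integral_of_dominated_loc_of_deriv_le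
    (F := fun (s : ℂ) (t : ℝ) => (Complex.exp ((t : ℂ) * s) - 1) / (t : ℂ))
    (F' := fun (s : ℂ) (t : ℝ) => Complex.exp ((t:ℂ) * s))
    (s := Metric.ball s 1) (bound := fun _ => Real.exp (‖s‖ + 1))
    (Metric.ball_mem_nhds s one_pos) ?_ ?_ ?_ ?_ ?_ ?_).2
  · filter_upwards with x
    refine Measurable.aestronglyMeasurable ?_
    fun_prop
  · apply ((hc s).intervalIntegrable 0 1).congr
    intro u hu
    rw [Set.uIoc_of_le zero_le_one] at hu
    simp only
    rw [dslope_of_ne _ hu.1.ne', slope_def_module]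
    simp [div_eq_inv_mul]
  · exact Continuous.aestronglyMeasurable (by fun_prop)
  · filter_upwards with t ht x hx
    rw [Set.uIoc_of_le zero_le_one] at ht
    rw [Complex.norm_exp]
    apply Real.exp_le_exp.2
    have h1 : ((t:ℂ) * x).re ≤ ‖(t:ℂ) * x‖ := Complex.re_le_norm _
    rw [norm_mul, Complex.norm_real, Real.norm_of_nonneg ht.1.le] at h1
    have h2 : ‖x‖ ≤ ‖s‖ + 1 := by
      have := norm_sub_norm_le x s
      rw [Metric.mem_ball, dist_eq_norm] at hx
      linarith
    have := norm_nonneg x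
    nlinarith [ht.1, ht.2]
  · simp
  · filter_upwards with t ht x hx
    rw [Set.uIoc_of_le zero_le_one] at ht
    have ht0 : (t:ℂ) ≠ 0 := by exact_mod_cast ht.1.ne'
    have := ((((hasDerivAt_id x).const_mul (t:ℂ)).cexp).sub_const 1).div_const (t:ℂ)
    refine this.congr_deriv ?_
    simp only [id]
    field_simp


lemma shift_int (f : ℝ → ℂ) (hf : IntegrableOn f (Set.Ioi 0)) :
    IntegrableOn (fun v => f (v - 1)) (Set.Ioi 1) ∧
    ∫ v in Set.Ioi (1:ℝ), f (v - 1) = ∫ v in Set.Ioi (0:ℝ), f v := by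
  have h : (Set.Ioi (1:ℝ)).indicator (fun v => f (v - 1)) =
      fun v => (Set.Ioi (0:ℝ)).indicator f (v - 1) := by
    ext v
    by_cases hv : 1 < v
    · simp [Set.indicator, hv]
    · simp [Set.indicator, hv]
  constructor
  · rw [← integrable_indicator_iff measurableSet_Ioi] at hf ⊢
    rw [h]
    exact hf.comp_sub_right 1
  · rw [← integral_indicator measurableSet_Ioi, ← integral_indicator measurableSet_Ioi, h]
    exact integral_sub_right_eq_self _ (1:ℝ)

lemma poly_exp (κ σ : ℝ) (hκ : 0 < κ) (hσ : 0 < σ) :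
    ∃ C, 0 ≤ C ∧ ∀ v : ℝ, 0 ≤ v → (1 + v) ^ κ ≤ C * Real.exp (σ * v) := by
  refine ⟨Real.exp (σ - κ - κ * Real.log (σ / κ)), (Real.exp_pos _).le, ?_⟩
  intro v hv
  have h1 : 0 < 1 + v := by linarith
  rw [Real.rpow_def_of_pos h1, ← Real.exp_add]
  apply Real.exp_le_exp.2
  have hp : 0 < σ / κ := by positivity
  have h2 := Real.log_le_sub_one_of_pos (mul_pos hp h1)
  rw [Real.log_mul hp.ne' h1.ne'] at h2
  have h3 := mul_le_mul_of_nonneg_left h2 hκ.le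
  have h4 : κ * (σ / κ * (1 + v) - 1) = σ * (1 + v) - κ := by field_simp
  rw [h4] at h3
  linarith

/-- basic data: continuous, nonnegative and subexponential -/
def SubExp (ψ : ℝ → ℝ) : Prop :=
  Continuous ψ ∧ (∀ v, 0 ≤ ψ v) ∧
    ∀ σ, 0 < σ → ∃ C, 0 ≤ C ∧ ∀ v : ℝ, 0 ≤ v → ψ v ≤ C * Real.exp (σ * v)

lemma base_int (r b : ℝ) (hr : -1 < r) (hb : 0 < b) :
    IntegrableOn (fun v : ℝ => v ^ r * Real.exp (-b * v)) (Set.Ioi 0) := by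
  have := integrableOn_rpow_mul_exp_neg_mul_rpow hr one_pos hb
  simpa using this

lemma norm_bd (ψ : ℝ → ℝ) (h0 : ∀ v, 0 ≤ ψ v) (C σ b r : ℝ)
    (hbd : ∀ v : ℝ, 0 ≤ v → ψ v ≤ C * Real.exp (σ * v))
    (s : ℂ) (hs : b + σ ≤ s.re) (v : ℝ) (hv : 0 < v) :
    ‖Complex.exp (-(v : ℂ) * s) * ((v ^ r * ψ v : ℝ) : ℂ)‖ ≤ C * (v ^ r * Real.exp (-b * v)) := by
  rw [norm_mul, Complex.norm_exp, Complex.norm_real, Real.norm_of_nonneg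
    (mul_nonneg (by positivity) (h0 v))]
  have h1 : (-(v:ℂ) * s).re = - v * s.re := by simp
  rw [h1]
  have h2 : Real.exp (-v * s.re) ≤ Real.exp (-b * v) * Real.exp (-(σ * v)) := by
    rw [← Real.exp_add]
    apply Real.exp_le_exp.2
    nlinarith
  calc Real.exp (-v * s.re) * (v ^ r * ψ v)
      ≤ (Real.exp (-b * v) * Real.exp (-(σ * v))) * (v ^ r * (C * Real.exp (σ * v))) := by
        gcongr
        exact mul_nonneg (by positivity) (h0 v)
        exact hbd v hv.le
    _ = C * (v ^ r * Real.exp (-b * v)) * (Real.exp (-(σ * v)) * Real.exp (σ * v)) := by ring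
    _ = _ := by rw [← Real.exp_add]; simp

lemma meas_aux (ψ : ℝ → ℝ) (hψ : Continuous ψ) (r : ℝ) (s : ℂ) (μ : Measure ℝ) :
    AEStronglyMeasurable (fun v : ℝ => Complex.exp (-(v : ℂ) * s) * ((v ^ r * ψ v : ℝ) : ℂ)) μ := by
  apply Measurable.aestronglyMeasurable
  have := hψ.measurable
  fun_prop

lemma lap_int (ψ : ℝ → ℝ) (hψ : SubExp ψ) (r : ℝ) (hr : -1 < r) (s : ℂ) (hs : 0 < s.re) :
    IntegrableOn (fun v : ℝ => Complex.exp (-(v : ℂ) * s) * ((v ^ r * ψ v : ℝ) : ℂ))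
      (Set.Ioi 0) := by
  obtain ⟨hc, h0, hb⟩ := hψ
  obtain ⟨C, hC, hbd⟩ := hb (s.re / 2) (by linarith)
  refine Integrable.mono' ((base_int r (s.re/2) hr (by linarith)).const_mul C)
    (meas_aux ψ hc r s _) ?_
  filter_upwards [ae_restrict_mem measurableSet_Ioi] with v hv
  exact norm_bd ψ h0 C (s.re/2) (s.re/2) r hbd s (by linarith) v hv

lemma lap_deriv (ψ : ℝ → ℝ) (hψ : SubExp ψ) (θ : ℝ) (h1 : θ < 1) (s : ℂ) (hs : 0 < s.re) :
    HasDerivAt (fun s : ℂ => ∫ v in Set.Ioi (0:ℝ),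
        Complex.exp (-(v : ℂ) * s) * ((v ^ (-θ) * ψ v : ℝ) : ℂ))
      (-∫ v in Set.Ioi (0:ℝ), Complex.exp (-(v : ℂ) * s) * ((v ^ (1 - θ) * ψ v : ℝ) : ℂ)) s := by
  rw [← integral_neg]
  obtain ⟨C, hC, hbd⟩ := hψ.2.2 (s.re / 4) (by linarith)
  refine (hasDerivAt_integral_of_dominated_loc_of_deriv_le
    (μ := volume.restrict (Set.Ioi (0:ℝ)))
    (F := fun (s : ℂ) (v : ℝ) => Complex.exp (-(v : ℂ) * s) * ((v ^ (-θ) * ψ v : ℝ) : ℂ))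
    (F' := fun (s : ℂ) (v : ℝ) => -(Complex.exp (-(v : ℂ) * s) * ((v ^ (1 - θ) * ψ v : ℝ) : ℂ)))
    (s := Metric.ball s (s.re / 2))
    (bound := fun v => C * (v ^ (1 - θ) * Real.exp (-(s.re / 4) * v)))
    (Metric.ball_mem_nhds s (by linarith)) ?_ ?_ ?_ ?_ ?_ ?_).2
  · filter_upwards with x
    exact meas_aux ψ hψ.1 _ _ _
  · exact lap_int ψ hψ (-θ) (by linarith) s hs
  · exact (meas_aux ψ hψ.1 _ _ _).neg
  · filter_upwards [ae_restrict_mem measurableSet_Ioi] with v hv x hx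
    rw [norm_neg]
    apply norm_bd ψ hψ.2.1 C (s.re/4) (s.re/4) (1-θ) hbd x _ v hv
    have h2 := Complex.abs_re_le_norm (x - s)
    rw [Metric.mem_ball, dist_eq_norm] at hx
    rw [Complex.sub_re] at h2
    have := neg_abs_le (x.re - s.re)
    linarith
  · exact (base_int _ _ (by linarith) (by linarith)).const_mul C
  · filter_upwards [ae_restrict_mem measurableSet_Ioi] with v hv x hx
    have hv : 0 < v := hv
    have := (((hasDerivAt_id x).const_mul (-(v:ℂ))).cexp).mul_const ((v ^ (-θ) * ψ v : ℝ) : ℂ)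
    refine this.congr_deriv ?_
    rw [show 1 - θ = 1 + -θ by ring, Real.rpow_add hv, Real.rpow_one]
    simp only [id]
    push_cast
    ring

open Filter Topology in
lemma lap_ibp (ψ : ℝ → ℝ) (hψ : SubExp ψ) (θ κ c : ℝ) (h1 : θ < 1)
    (hc : ∀ v ≤ 1, ψ v = c)
    (hd : ∀ v, 1 < v → HasDerivAt ψ (κ * (v ^ (θ - 1) * (v - 1) ^ (-θ) * ψ (v - 1))) v)
    (s : ℂ) (hs : 0 < s.re) :
    s * ∫ v in Set.Ioi (0:ℝ), Complex.exp (-(v : ℂ) * s) * ((v ^ (1 - θ) * ψ v : ℝ) : ℂ) =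
    ((1 - θ) + κ * Complex.exp (-s)) *
      ∫ v in Set.Ioi (0:ℝ), Complex.exp (-(v : ℂ) * s) * ((v ^ (-θ) * ψ v : ℝ) : ℂ) := by
  set Q : ℝ → ℂ := fun v => Complex.exp (-(v : ℂ) * s) * ((v ^ (1 - θ) * ψ v : ℝ) : ℂ) with hQ
  set P : ℝ → ℂ := fun v => Complex.exp (-(v : ℂ) * s) * ((v ^ (-θ) * ψ v : ℝ) : ℂ) with hP
  have iQ : IntegrableOn Q (Set.Ioi 0) := lap_int ψ hψ _ (by linarith) s hs
  have iP : IntegrableOn P (Set.Ioi 0) := lap_int ψ hψ _ (by linarith) s hs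
  obtain ⟨iS, eS⟩ := shift_int P iP
  have hQc : Continuous Q := by
    have := hψ.1
    have h2 : Continuous (fun v : ℝ => v ^ (1 - θ)) :=
      continuous_id.rpow_const (fun x => Or.inr (by linarith))
    fun_prop
  -- derivative given the derivative of ψ
  have hder : ∀ v d, 0 < v → HasDerivAt ψ d v →
      HasDerivAt Q (-s * Q v + (1 - θ) * P v + Complex.exp (-(v : ℂ) * s) * ((v ^ (1 - θ) * d : ℝ):ℂ)) v := by
    intro v d hv hd
    have a1 : HasDerivAt (fun v : ℝ => Complex.exp (-(v : ℂ) * s)) _ v :=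
      (((Complex.ofRealCLM.hasDerivAt (x := v)).neg.mul_const s).cexp)
    have a2 := ((Real.hasDerivAt_rpow_const (p := 1 - θ) (Or.inl hv.ne')).mul hd).ofReal_comp
    refine (a1.mul a2).congr_deriv ?_
    simp only [hQ, hP, show 1 - θ - 1 = -θ by ring]
    simp
    ring
  have iQ1 : IntegrableOn Q (Set.Ioc 0 1) := iQ.mono_set Set.Ioc_subset_Ioi_self
  have iP1 : IntegrableOn P (Set.Ioc 0 1) := iP.mono_set Set.Ioc_subset_Ioi_self
  have iQ2 : IntegrableOn Q (Set.Ioi 1) := iQ.mono_set (Set.Ioi_subset_Ioi zero_le_one)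
  have iP2 : IntegrableOn P (Set.Ioi 1) := iP.mono_set (Set.Ioi_subset_Ioi zero_le_one)
  have A : ∫ v in Set.Ioc (0:ℝ) 1, (-s * Q v + (1 - θ) * P v) = Q 1 - Q 0 := by
    rw [← intervalIntegral.integral_of_le zero_le_one]
    apply intervalIntegral.integral_eq_sub_of_hasDerivAt_of_le zero_le_one hQc.continuousOn
    · intro v hv
      have hd0 : HasDerivAt ψ 0 v := by
        apply (hasDerivAt_const v c).congr_of_eventuallyEq
        filter_upwards [gt_mem_nhds hv.2] with x hx
        exact hc x hx.le
      have := hder v 0 hv.1 hd0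
      simpa using this
    · rw [intervalIntegrable_iff_integrableOn_Ioc_of_le zero_le_one]
      exact (iQ1.const_mul _).add (iP1.const_mul _)
  have hQ0 : Q 0 = 0 := by
    simp [hQ, Real.zero_rpow (show 1 - θ ≠ 0 by linarith)]
  have B : ∫ v in Set.Ioi (1:ℝ), (-s * Q v + (1 - θ) * P v + κ * Complex.exp (-s) * P (v - 1)) = 0 - Q 1 := by
    apply integral_Ioi_of_hasDerivAt_of_tendsto hQc.continuousWithinAt
    · intro v hv
      have hv : 1 < v := hv
      have hv0 : 0 < v := by linarith
      refine (hder v _ hv0 (hd v hv)).congr_deriv ?_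
      congr 1
      simp only [hP]
      have e1 : Complex.exp (-(v:ℂ) * s) = Complex.exp (-s) * Complex.exp (-((v - 1 : ℝ) : ℂ) * s) := by
        rw [← Complex.exp_add]; congr 1; push_cast; ring
      have e2 : v ^ (1 - θ) * (κ * (v ^ (θ - 1) * (v - 1) ^ (-θ) * ψ (v - 1))) =
          κ * ((v - 1) ^ (-θ) * ψ (v - 1)) := by
        have : v ^ (1 - θ) * v ^ (θ - 1) = 1 := by
          rw [← Real.rpow_add hv0]; simp
        calc _ = (v ^ (1 - θ) * v ^ (θ - 1)) * (κ * ((v - 1) ^ (-θ) * ψ (v - 1))) := by ring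
          _ = _ := by rw [this, one_mul]
      rw [e1, e2]
      push_cast
      ring
    · exact ((iQ2.const_mul _).add (iP2.const_mul _)).add (iS.const_mul _)
    · obtain ⟨C, hC, hbd⟩ := hψ.2.2 (s.re / 2) (by linarith)
      have ht := (tendsto_rpow_mul_exp_neg_mul_atTop_nhds_zero (1 - θ) (s.re/2) (by linarith)).const_mul C
      rw [mul_zero] at ht
      refine squeeze_zero_norm' ?_ ht
      filter_upwards [eventually_gt_atTop 0] with v hv
      exact norm_bd ψ hψ.2.1 C (s.re/2) (s.re/2) (1-θ) hbd s (by linarith) v hv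
  have i3 : IntegrableOn (fun v => -s * Q v + (1 - θ) * P v) (Set.Ioi 1) :=
    (iQ2.const_mul _).add (iP2.const_mul _)
  rw [integral_add i3 (iS.const_mul _),
    integral_add (iQ2.const_mul _) (iP2.const_mul _), integral_const_mul, integral_const_mul,
    integral_const_mul, eS] at B
  rw [integral_add (iQ1.const_mul _) (iP1.const_mul _), integral_const_mul, integral_const_mul, hQ0] at A
  have sQ : ∫ v in Set.Ioi (0:ℝ), Q v = (∫ v in Set.Ioc (0:ℝ) 1, Q v) + ∫ v in Set.Ioi (1:ℝ), Q v := by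
    rw [← setIntegral_union (Set.Ioc_disjoint_Ioi le_rfl) measurableSet_Ioi iQ1 iQ2,
      Set.Ioc_union_Ioi_eq_Ioi zero_le_one]
  have sP : ∫ v in Set.Ioi (0:ℝ), P v = (∫ v in Set.Ioc (0:ℝ) 1, P v) + ∫ v in Set.Ioi (1:ℝ), P v := by
    rw [← setIntegral_union (Set.Ioc_disjoint_Ioi le_rfl) measurableSet_Ioi iP1 iP2,
      Set.Ioc_union_Ioi_eq_Ioi zero_le_one]
  linear_combination (-1 : ℂ) * A - B + s * sQ - (1 - θ) * sP

open Filter Topology in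
lemma lap_limit (ψ : ℝ → ℝ) (hψ : SubExp ψ) (θ c : ℝ) (h1 : θ < 1) (hc : ψ 0 = c) :
    Tendsto (fun x : ℝ => x ^ (1 - θ) * ∫ v in Set.Ioi (0:ℝ), Real.exp (-v * x) * (v ^ (-θ) * ψ v))
      atTop (𝓝 (c * Real.Gamma (1 - θ))) := by
  have key : ∀ x : ℝ, 0 < x →
      x ^ (1 - θ) * ∫ v in Set.Ioi (0:ℝ), Real.exp (-v * x) * (v ^ (-θ) * ψ v) =
      ∫ t in Set.Ioi (0:ℝ), Real.exp (-t) * t ^ (-θ) * ψ (x⁻¹ * t) := by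
    intro x hx
    have := integral_comp_mul_left_Ioi (fun v => Real.exp (-v * x) * (v ^ (-θ) * ψ v)) 0 (inv_pos.2 hx)
    simp only [mul_zero, inv_inv, smul_eq_mul] at this
    rw [show 1 - θ = -θ + 1 by ring, Real.rpow_add hx, Real.rpow_one, mul_assoc, ← this,
      ← integral_const_mul]
    apply setIntegral_congr_fun measurableSet_Ioi
    intro t ht
    have ht : 0 < t := ht
    simp only
    rw [Real.mul_rpow (by positivity) ht.le, Real.inv_rpow hx.le]
    have e : -(x⁻¹ * t) * x = -t := by field_simp
    rw [e]
    have : x ^ (-θ) ≠ 0 := (Real.rpow_pos_of_pos hx _).ne'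
    field_simp
  obtain ⟨C, hC, hbd⟩ := hψ.2.2 (1 / 2) (by norm_num)
  have hG : c * Real.Gamma (1 - θ) = ∫ t in Set.Ioi (0:ℝ), Real.exp (-t) * t ^ (-θ) * c := by
    rw [integral_mul_const, Real.Gamma_eq_integral (by linarith), mul_comm]
    congr 2
    ext t
    congr 2
    ring
  rw [hG]
  have lim : Tendsto (fun x : ℝ => ∫ t in Set.Ioi (0:ℝ), Real.exp (-t) * t ^ (-θ) * ψ (x⁻¹ * t))
      atTop (𝓝 (∫ t in Set.Ioi (0:ℝ), Real.exp (-t) * t ^ (-θ) * c)) := by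
    apply tendsto_integral_filter_of_dominated_convergence
      (fun t => C * (t ^ (-θ) * Real.exp (-(1/2) * t)))
    · filter_upwards with x
      apply Measurable.aestronglyMeasurable
      have := hψ.1.measurable
      fun_prop
    · filter_upwards [eventually_ge_atTop 1] with x hx
      filter_upwards [ae_restrict_mem measurableSet_Ioi] with t ht
      have ht : 0 < t := ht
      have hx0 : 0 < x := by linarith
      have hxi : x⁻¹ ≤ 1 := inv_le_one_of_one_le₀ hx
      have hn : 0 ≤ ψ (x⁻¹ * t) := hψ.2.1 _
      rw [Real.norm_of_nonneg (by positivity)]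
      have hb : ψ (x⁻¹ * t) ≤ C * Real.exp (1/2 * t) := by
        refine (hbd _ (by positivity)).trans ?_
        gcongr
        nlinarith
      calc Real.exp (-t) * t ^ (-θ) * ψ (x⁻¹ * t)
          ≤ Real.exp (-t) * t ^ (-θ) * (C * Real.exp (1/2 * t)) := by gcongr
        _ = C * (t ^ (-θ) * (Real.exp (-t) * Real.exp (1/2 * t))) := by ring
        _ = _ := by rw [← Real.exp_add]; congr 3; ring
    · exact (base_int _ _ (by linarith) (by norm_num)).const_mul C
    · filter_upwards with t
      apply Tendsto.const_mul
      have h2 : Tendsto (fun x : ℝ => x⁻¹ * t) atTop (𝓝 0) := by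
        simpa using tendsto_inv_atTop_zero.mul_const t
      have := (hψ.1.tendsto 0).comp h2
      rw [hc] at this
      exact this
  refine lim.congr' ?_
  filter_upwards [eventually_gt_atTop 0] with x hx
  exact (key x hx).symm

open Filter Topology in
lemma lap_final (κ : ℝ) (hκ : 0 < κ) (ν : ℕ) (ϑ : ℝ) (h1 : ϑ < 1) (hϑ : ϑ = κ - ν)
    (I : ℂ → ℂ)
    (hI : ∀ s : ℂ, I s = ∫ t in (0:ℝ)..1, (Complex.exp ((t : ℂ) * s) - 1) / (t : ℂ))
    (ψ : ℝ → ℝ) (hS : SubExp ψ) (c : ℝ) (hcΓ : c * Real.Gamma (1 - ϑ) = 1)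
    (hc : ∀ v ≤ 1, ψ v = c)
    (hd : ∀ v, 1 < v → HasDerivAt ψ (κ * (v ^ (ϑ - 1) * (v - 1) ^ (-ϑ) * ψ (v - 1))) v)
    (s : ℂ) (hs : 0 < s.re) :
    ∫ v in Set.Ioi (0:ℝ), Complex.exp (-(v : ℂ) * s) * ((v ^ (-ϑ) * ψ v : ℝ) : ℂ)
          = 1 / (s ^ (ν + 1) *
              Complex.exp ((κ : ℂ) * ((Real.eulerMascheroniConstant : ℂ) + I (-s)))) := by
  set F : ℂ → ℂ := fun s => ∫ v in Set.Ioi (0:ℝ),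
    Complex.exp (-(v : ℂ) * s) * ((v ^ (-ϑ) * ψ v : ℝ) : ℂ) with hF
  set K : ℂ → ℂ := fun s => F s * (s ^ (ν + 1) * Complex.exp (κ * I (-s))) with hK
  have hϑc : (ϑ : ℂ) = κ - ν := by rw [hϑ]; push_cast; rfl
  have hder : ∀ s : ℂ, 0 < s.re → HasDerivAt K 0 s := by
    intro s hs
    have hs0 : s ≠ 0 := by
      rintro rfl
      simp at hs
    have a1 := lap_deriv ψ hS ϑ h1 s hs
    have a2 := lap_ibp ψ hS ϑ κ c h1 hc hd s hs
    set R := ∫ v in Set.Ioi (0:ℝ), Complex.exp (-(v : ℂ) * s) * ((v ^ (1 - ϑ) * ψ v : ℝ) : ℂ)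
    have hId : HasDerivAt (fun s => I (-s)) ((Complex.exp (-s) - 1) / s) s := by
      have b1 := I_deriv (-s) (neg_ne_zero.2 hs0)
      rw [← funext hI] at b1
      have b2 := b1.comp s (hasDerivAt_neg s)
      refine b2.congr_deriv ?_
      field_simp
    have a3 := (hasDerivAt_pow (ν + 1) s).mul ((hId.const_mul (κ:ℂ)).cexp)
    refine (a1.mul a3).congr_deriv ?_
    have a2' : s * R = ((1 - ϑ) + κ * Complex.exp (-s)) * F s := a2
    have hFs : (∫ v in Set.Ioi (0:ℝ), Complex.exp (-(v : ℂ) * s) * ((v ^ (-ϑ) * ψ v : ℝ) : ℂ)) = F s := rfl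
    simp only [Pi.mul_apply, hFs, Nat.add_sub_cancel]
    set E := Complex.exp (κ * I (-s))
    set X := Complex.exp (-s)
    rw [hϑc] at a2'
    have e1 : s ^ (ν + 1) * (E * (κ * ((X - 1) / s))) = s ^ ν * E * κ * (X - 1) := by
      field_simp
      ring
    rw [e1]
    push_cast
    linear_combination (-(s ^ ν * E)) * a2'
  have hconst : ∀ x y : ℂ, 0 < x.re → 0 < y.re → K x = K y := by
    intro x y hx hy
    have ho : IsOpen {z : ℂ | 0 < z.re} := isOpen_lt continuous_const Complex.continuous_re
    refine ho.is_const_of_deriv_eq_zero (convex_halfSpace_re_gt 0).isPreconnected ?_ ?_ hx hy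
    · intro z hz
      exact (hder z hz).differentiableAt.differentiableWithinAt
    · intro z hz
      exact (hder z hz).deriv
  have hlim : Tendsto (fun x : ℝ => K (x : ℂ)) atTop
      (𝓝 (Complex.exp (-(κ * Real.eulerMascheroniConstant)))) := by
    have l1 := lap_limit ψ hS ϑ c h1 (hc 0 zero_le_one)
    rw [hcΓ] at l1
    have l2 := (Real.continuous_exp.tendsto _).comp (J_tendsto.const_mul κ)
    have l3 := (Complex.continuous_ofReal.tendsto _).comp (l1.mul l2)
    have e : ((1 * Real.exp (κ * -Real.eulerMascheroniConstant) : ℝ) : ℂ) =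
        Complex.exp (-(κ * Real.eulerMascheroniConstant)) := by
      push_cast
      rw [one_mul]; congr 1; ring
    rw [e] at l3
    refine l3.congr' ?_
    filter_upwards [eventually_gt_atTop 0] with x hx
    have hFx : F (x:ℂ) = ((∫ v in Set.Ioi (0:ℝ), Real.exp (-v * x) * (v ^ (-ϑ) * ψ v) : ℝ) : ℂ) := by
      rw [← integral_complex_ofReal]
      simp only [hF]
      congr 1
      ext v
      push_cast
      rfl
    simp only [hK, Function.comp]
    rw [hFx, hI, I_real]
    set J := ∫ t in (0:ℝ)..1, (Real.exp (-(t * x)) - 1) / t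
    have hpow : x ^ (ν + 1) = x ^ (1 - ϑ) * Real.exp (κ * Real.log x) := by
      rw [mul_comm κ, ← Real.rpow_def_of_pos hx, ← Real.rpow_add hx, ← Real.rpow_natCast]
      congr 1
      rw [hϑ]; push_cast; ring
    rw [← Complex.ofReal_pow, hpow, mul_add, Real.exp_add]
    push_cast
    ring
  have hKs : K s = Complex.exp (-(κ * Real.eulerMascheroniConstant)) := by
    refine tendsto_nhds_unique (tendsto_const_nhds.congr' ?_) hlim
    filter_upwards [eventually_gt_atTop 0] with x hx
    exact hconst _ _ hs (by simpa using hx)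
  have hs0 : s ≠ 0 := by
    rintro rfl
    simp at hs
  change F s = _
  rw [eq_div_iff (mul_ne_zero (pow_ne_zero _ hs0) (Complex.exp_ne_zero _)), mul_add, Complex.exp_add]
  have : F s * (s ^ (ν + 1) * Complex.exp (κ * I (-s))) =
    Complex.exp (-(κ * Real.eulerMascheroniConstant)) := hKs
  calc _ = Complex.exp (κ * Real.eulerMascheroniConstant) *
        (F s * (s ^ (ν + 1) * Complex.exp (κ * I (-s)))) := by ring
    _ = 1 := by rw [this, ← Complex.exp_add]; simp

/-- Existence of `φ_κ` solving `v φ' + ϑ φ − κ φ(·−1) = 0` with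
`φ(v) = v^{−ϑ}/Γ(1−ϑ)` on `(0,1]`, and the formula
`φ̂_κ(s) = 1/(s^{ν+1} ϱ̂(s)^κ)` for `Re s > 0`. -/
theorem phi_kappa_exists_laplace (κ : ℝ) (hκ : 0 < κ) (ν : ℕ) (ϑ : ℝ)
    (hν : ν = ⌊κ⌋₊) (hϑ : ϑ = κ - ν)
    (I : ℂ → ℂ)
    (hI : ∀ s : ℂ, I s = ∫ t in (0:ℝ)..1, (Complex.exp ((t : ℂ) * s) - 1) / (t : ℂ)) :
    ∃ φ : ℝ → ℝ,
      ContinuousOn φ (Set.Ioi 0) ∧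
      (∀ v ∈ Set.Ioc (0:ℝ) 1, φ v = v ^ (-ϑ) / Real.Gamma (1 - ϑ)) ∧
      (∀ v : ℝ, 1 < v → HasDerivAt φ ((κ * φ (v - 1) - ϑ * φ v) / v) v) ∧
      (∀ s : ℂ, 0 < s.re →
        ∫ v in Set.Ioi (0:ℝ), Complex.exp (-(v : ℂ) * s) * (φ v : ℂ)
          = 1 / (s ^ (ν + 1) *
              Complex.exp ((κ : ℂ) * ((Real.eulerMascheroniConstant : ℂ) + I (-s))))) := by
  have h0 : 0 ≤ ϑ := by
    have := Nat.floor_le hκ.le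
    rw [hϑ, hν]; linarith
  have h1 : ϑ < 1 := by
    have := Nat.lt_floor_add_one κ
    rw [hϑ, hν]; linarith
  have hΓ : 0 < Real.Gamma (1 - ϑ) := Real.Gamma_pos_of_pos (by linarith)
  obtain ⟨ψ, hψc, hψ1, hψd, hψ0, A, hA, hAb⟩ :=
    exists_psi ϑ κ (1 / Real.Gamma (1 - ϑ)) h1 hκ (by positivity)
  have hS : SubExp ψ := by
    refine ⟨hψc, hψ0, fun σ hσ => ?_⟩
    obtain ⟨C, hC, hCb⟩ := poly_exp κ σ hκ hσ
    refine ⟨A * C, by positivity, fun v hv => (hAb v hv).trans ?_⟩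
    rw [mul_assoc]
    exact mul_le_mul_of_nonneg_left (hCb v hv) hA
  refine ⟨fun v => v ^ (-ϑ) * ψ v, ?_, ?_, ?_, ?_⟩
  · apply ContinuousOn.mul _ hψc.continuousOn
    intro v hv
    have hv : 0 < v := hv
    exact (Real.continuousAt_rpow_const v (-ϑ) (Or.inl hv.ne')).continuousWithinAt
  · intro v hv
    simp only
    rw [hψ1 v hv.2]
    ring
  · intro v hv
    have hv0 : 0 < v := by linarith
    have := (Real.hasDerivAt_rpow_const (p := -ϑ) (Or.inl hv0.ne')).mul (hψd v hv)
    refine this.congr_deriv ?_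
    rw [Real.rpow_sub_one hv0.ne', Real.rpow_sub_one hv0.ne']
    have e : v ^ (-ϑ) * v ^ ϑ = 1 := by rw [← Real.rpow_add hv0]; simp
    have hne := hv0.ne'
    field_simp
    linear_combination (κ * (v - 1) ^ (-ϑ) * ψ (v - 1)) * e
  · exact lap_final κ hκ ν ϑ h1 hϑ I hI ψ hS _ (by field_simp) hψ1 hψd
end
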